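/- arXiv:1305.1098 — 2 statements merged into one kernel-verified Lean document; each statement's English description precedes it below -/
import Mathlib

section
/- Let T be a triangulation of a convex n-gon and M_T its matrix of path numbers. Then every adjacent 2×2 minor d(e,f) = m_{i,j} m_{i+1,j+1} − m_{i,j+1} m_{i+1,j} for distinct boundary edges e = (i,i+1), f = (j,j+1) equals 1; hence the associated array is a Conway–Coxeter frieze pattern. -/
noncomputable section

/-- The `k`-th vertex of a regular `n`-gon inscribed in the unit circle. -/
def vtx (n : ℕ) (k : ZMod n) : ℝ × ℝ :=
  (Real.cos (2 * Real.pi * k.val / n), Real.sin (2 * Real.pi * k.val / n))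

/-- The convex hull spanned by a set `c` of vertices of the `n`-gon. -/
def cellHull (n : ℕ) (c : Finset (ZMod n)) : Set (ℝ × ℝ) :=
  convexHull ℝ (vtx n '' (c : Set (ZMod n)))

/-- `T` is a `d`-angulation of the convex `n`-gon: a dissection of the polygon by
pairwise non-crossing diagonals into `d`-gon cells.  Each cell is recorded by its
vertex set; the cells cover the polygon and have pairwise disjoint interiors. -/
def IsDAngulation (n d : ℕ) (T : Finset (Finset (ZMod n))) : Prop :=
  (∀ c ∈ T, c.card = d) ∧
  (⋃ c ∈ T, cellHull n c) = convexHull ℝ (Set.range (vtx n)) ∧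
  ∀ c ∈ T, ∀ c' ∈ T, c ≠ c' →
    interior (cellHull n c) ∩ interior (cellHull n c') = ∅

/-- The number of vertices strictly between `i` and `j`, going counterclockwise. -/
def pathLen (n : ℕ) (i j : ZMod n) : ℕ := (j - i - 1).val

/-- A (counterclockwise) `d`-path from `i` to `j` in the `d`-angulation `T`:
a sequence `p_{i+1}, …, p_{j-1}` of cells of `T`, indexed by the vertices
encountered going counterclockwise from `i` to `j`, such that the cell at
position `k` is incident to the vertex `i+1+k`, and each cell of `T` occurs
at most `d - 2` times in the sequence. -/
def IsDPath (n d : ℕ) (T : Finset (Finset (ZMod n))) (i j : ZMod n)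
    (q : Fin (pathLen n i j) → {c // c ∈ T}) : Prop :=
  (∀ k, (i + 1 + ((k : ℕ) : ZMod n)) ∈ (q k : Finset (ZMod n))) ∧
  ∀ c ∈ T, (Finset.univ.filter (fun k => (q k : Finset (ZMod n)) = c)).card ≤ d - 2

/-- The number `m_{i,j}` of counterclockwise `d`-paths from `i` to `j`. -/
def dPathCount (n d : ℕ) (T : Finset (Finset (ZMod n))) (i j : ZMod n) : ℕ :=
  Nat.card {q : Fin (pathLen n i j) → {c // c ∈ T} // IsDPath n d T i j q}

section Counting

variable {α : Type*} [DecidableEq α]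

/-- The number of ways of choosing pairwise distinct elements `t_s, …, t_{s+l-1}` of `T`
with `k ∈ V t_k` for every `k`. -/
def sdrCount (V : α → Finset ℕ) : ℕ → ℕ → Finset α → ℕ
  | _, 0, _ => 1
  | s, l + 1, T => ∑ t ∈ T with s ∈ V t, sdrCount V (s + 1) l (T.erase t)

variable {V : α → Finset ℕ}

theorem sdrCount_succ_union {s : ℕ} (l : ℕ) (L : Finset α) {U : Finset α}
    (hU : ∀ t ∈ U, s ∉ V t) :
    sdrCount V s (l + 1) (L ∪ U) =
      ∑ t ∈ L with s ∈ V t, sdrCount V (s + 1) l (L.erase t ∪ U) := by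
  have hfilter : (L ∪ U).filter (s ∈ V ·) = L.filter (s ∈ V ·) := by
    ext t
    simp only [Finset.mem_filter, Finset.mem_union]
    exact ⟨fun ⟨h, hs⟩ => ⟨h.resolve_right fun ht => hU t ht hs, hs⟩,
      fun ⟨h, hs⟩ => ⟨Or.inl h, hs⟩⟩
  rw [sdrCount, hfilter]
  refine Finset.sum_congr rfl fun t ht => ?_
  have htU : t ∉ U := fun h => hU t h (Finset.mem_filter.1 ht).2
  rw [Finset.erase_union_distrib, Finset.erase_eq_of_notMem htU]

theorem sdrCount_union_of_notMem (s l : ℕ) (L : Finset α) {U : Finset α}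
    (hU : ∀ t ∈ U, ∀ k, s ≤ k → k < s + l → k ∉ V t) :
    sdrCount V s l (L ∪ U) = sdrCount V s l L := by
  induction l generalizing s L with
  | zero => rfl
  | succ l ih =>
    rw [sdrCount_succ_union l L fun t ht => hU t ht s le_rfl (by omega), sdrCount]
    exact Finset.sum_congr rfl fun t _ =>
      ih _ _ fun u hu k h₁ h₂ => hU u hu k (by omega) (by omega)

theorem sdrCount_union_eq_zero (s k l : ℕ) (L : Finset α) {U : Finset α} (hL : L.card < k)
    (hU : ∀ t ∈ U, ∀ m, s ≤ m → m < s + k → m ∉ V t) :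
    sdrCount V s (k + l) (L ∪ U) = 0 := by
  induction k generalizing s L with
  | zero => omega
  | succ k ih =>
    rw [Nat.add_right_comm,
      sdrCount_succ_union _ L fun t ht => hU t ht s le_rfl (by omega)]
    refine Finset.sum_eq_zero fun t ht => ih _ _ ?_
      fun u hu m h₁ h₂ => hU u hu m (by omega) (by omega)
    have := Finset.card_erase_lt_of_mem (Finset.mem_filter.1 ht).1
    omega

theorem sdrCount_eq_zero {s k : ℕ} {L : Finset α} (hL : L.card < k) :
    sdrCount V s k L = 0 := by
  simpa using sdrCount_union_eq_zero (V := V) s k 0 L (U := ∅) hL (by simp)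

theorem sdrCount_union (s k l : ℕ) (L : Finset α) {U : Finset α} (hL : L.card = k)
    (hU : ∀ t ∈ U, ∀ m, s ≤ m → m < s + k → m ∉ V t) :
    sdrCount V s (k + l) (L ∪ U) = sdrCount V s k L * sdrCount V (s + k) l U := by
  induction k generalizing s L with
  | zero => simp [Finset.card_eq_zero.1 hL, sdrCount]
  | succ k ih =>
    rw [Nat.add_right_comm,
      sdrCount_succ_union _ L fun t ht => hU t ht s le_rfl (by omega), sdrCount, Finset.sum_mul]
    refine Finset.sum_congr rfl fun t ht => ?_
    rw [ih (s + 1) (L.erase t) ?_ fun u hu m h₁ h₂ => hU u hu m (by omega) (by omega),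
      show s + 1 + k = s + (k + 1) by omega]
    rw [Finset.card_erase_of_mem (Finset.mem_filter.1 ht).1]
    omega

theorem sdrCount_insert {s l : ℕ} {L : Finset α} {t : α} (ht : t ∉ L) (hs : s ∈ V t)
    (hV : ∀ k, s < k → k ≤ s + l → k ∉ V t) :
    sdrCount V s (l + 1) (insert t L) =
      sdrCount V (s + 1) l L + sdrCount V s (l + 1) L := by
  rw [sdrCount, Finset.filter_insert, if_pos hs, Finset.sum_insert (by simp [ht]),
    Finset.erase_insert ht, sdrCount]
  congr 1
  refine Finset.sum_congr rfl fun u hu => ?_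
  have hut : t ≠ u := fun h => ht (h ▸ (Finset.mem_filter.1 hu).1)
  rw [Finset.erase_insert_of_ne hut, Finset.insert_eq, Finset.union_comm]
  refine sdrCount_union_of_notMem _ _ _ fun v hv k h₁ h₂ => ?_
  rw [Finset.mem_singleton.1 hv]
  exact hV k (by omega) (by omega)

theorem sdrCount_eq_card (s l : ℕ) (T : Finset α) :
    Nat.card {q : Fin l → α //
      (∀ k, q k ∈ T ∧ s + (k : ℕ) ∈ V (q k)) ∧ Function.Injective q} = sdrCount V s l T := by
  induction l generalizing s T with
  | zero =>
    rw [sdrCount, Nat.card_eq_one_iff_unique]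
    exact ⟨⟨fun a b => Subtype.ext (Subsingleton.elim _ _)⟩,
      ⟨⟨Fin.elim0, fun k => k.elim0, fun k => k.elim0⟩⟩⟩
  | succ l ih =>
    have hfin (T' : Finset α) (s' : ℕ) : Finite {q : Fin l → α //
        (∀ k, q k ∈ T' ∧ s' + (k : ℕ) ∈ V (q k)) ∧ Function.Injective q} :=
      Finite.of_injective (fun q k => (⟨q.1 k, (q.2.1 k).1⟩ : T')) fun q r h => by
        ext k
        exact congrArg Subtype.val (congrFun h k)
    have e : {q : Fin (l + 1) → α //
          (∀ k, q k ∈ T ∧ s + (k : ℕ) ∈ V (q k)) ∧ Function.Injective q} ≃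
        Σ t : {t // t ∈ T.filter (s ∈ V ·)}, {q : Fin l → α //
          (∀ k, q k ∈ T.erase t.1 ∧ s + 1 + (k : ℕ) ∈ V (q k)) ∧ Function.Injective q} :=
      { toFun := fun q => ⟨⟨q.1 0, Finset.mem_filter.2 ⟨(q.2.1 0).1, by simpa using (q.2.1 0).2⟩⟩,
          ⟨fun k => q.1 k.succ, fun k => ⟨Finset.mem_erase.2
            ⟨fun h => Fin.succ_ne_zero k (q.2.2 h), (q.2.1 _).1⟩, by
              have := (q.2.1 k.succ).2
              rwa [Fin.val_succ, add_comm (k : ℕ) 1, ← add_assoc] at this⟩,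
            q.2.2.comp (Fin.succ_injective l)⟩⟩
        invFun := fun p => ⟨Fin.cons p.1.1 p.2.1, fun k => by
            refine Fin.cases ?_ (fun k => ?_) k
            · simpa using Finset.mem_filter.1 p.1.2
            · have := p.2.2.1 k
              refine ⟨by simpa using Finset.mem_of_mem_erase this.1, ?_⟩
              rw [Fin.cons_succ, Fin.val_succ, add_comm (k : ℕ) 1, ← add_assoc]
              exact this.2,
          Fin.cons_injective_iff.2 ⟨by
            rintro ⟨k, hk⟩
            exact Finset.ne_of_mem_erase (p.2.2.1 k).1 hk, p.2.2.2⟩⟩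
        left_inv := fun q => Subtype.ext (Fin.cons_self_tail q.1)
        right_inv := fun p => by
          rcases p with ⟨t, q⟩
          rfl }
    rw [Nat.card_congr e, Nat.card_sigma, sdrCount,
      ← Finset.sum_coe_sort (T.filter (s ∈ V ·))]
    exact Finset.sum_congr rfl fun t _ => ih _ _

/-- `IsTriangulated V a b X`: the triangles in `X` dissect the polygon on the
vertices `a, a + 1, …, b`. -/
inductive IsTriangulated (V : α → Finset ℕ) : ℕ → ℕ → Finset α → Prop
  | edge (a : ℕ) : IsTriangulated V a (a + 1) ∅
  | glue {a c b : ℕ} {t : α} {L R : Finset α} (hac : a < c) (hcb : c < b)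
      (ht : V t = {a, c, b}) (hL : IsTriangulated V a c L) (hR : IsTriangulated V c b R)
      (htL : t ∉ L) (htR : t ∉ R) (hLR : Disjoint L R) :
      IsTriangulated V a b (insert t (L ∪ R))

namespace IsTriangulated

variable {a b : ℕ} {X : Finset α}

theorem card_add_one (h : IsTriangulated V a b X) : X.card + 1 + a = b := by
  induction h with
  | edge a => simp; omega
  | glue hac hcb ht hL hR htL htR hLR ihL ihR =>
    rw [Finset.card_insert_of_notMem (by simp [htL, htR]), Finset.card_union_of_disjoint hLR]
    omega

theorem subset_Icc (h : IsTriangulated V a b X) {t : α} (ht : t ∈ X) : V t ⊆ Finset.Icc a b := by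
  induction h with
  | edge a => simp at ht
  | glue hac hcb hV hL hR htL htR hLR ihL ihR =>
    intro k hk
    rw [Finset.mem_insert, Finset.mem_union] at ht
    rw [Finset.mem_Icc]
    rcases ht with rfl | ht | ht
    · simp only [hV, Finset.mem_insert, Finset.mem_singleton] at hk
      omega
    · have := Finset.mem_Icc.1 (ihL ht hk)
      omega
    · have := Finset.mem_Icc.1 (ihR ht hk)
      omega

section Glue

variable {k : ℕ} {t : α} {L R : Finset α}

theorem sdrCount_glue_left (hb : a + 1 + k < b) (ht : V t = {a, a + 1 + k, b})
    (hR : IsTriangulated V (a + 1 + k) b R) {m : ℕ} (hm : m ≤ k) :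
    sdrCount V (a + 1) m (insert t (L ∪ R)) = sdrCount V (a + 1) m L := by
  rw [← Finset.union_insert]
  refine sdrCount_union_of_notMem _ _ _ fun u hu x h₁ h₂ hx => ?_
  rcases Finset.mem_insert.1 hu with rfl | hu
  · simp only [ht, Finset.mem_insert, Finset.mem_singleton] at hx
    omega
  · have := Finset.mem_Icc.1 (hR.subset_Icc hu hx)
    omega

theorem sdrCount_glue_left_succ (hb : a + 1 + k < b) (ht : V t = {a, a + 1 + k, b})
    (hR : IsTriangulated V (a + 1 + k) b R) (htL : t ∉ L) {m : ℕ} (hm : m ≤ k) :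
    sdrCount V a (m + 1) (insert t (L ∪ R)) =
      sdrCount V (a + 1) m L + sdrCount V a (m + 1) L := by
  rw [← Finset.insert_union, sdrCount_union_of_notMem]
  · refine sdrCount_insert htL (by simp [ht]) fun x h₁ h₂ hx => ?_
    simp only [ht, Finset.mem_insert, Finset.mem_singleton] at hx
    omega
  · intro u hu x h₁ h₂ hx
    have := Finset.mem_Icc.1 (hR.subset_Icc hu hx)
    omega

theorem sdrCount_glue_right (hb : a + 1 + k < b) (ht : V t = {a, a + 1 + k, b})
    (hL : IsTriangulated V a (a + 1 + k) L) (hR : IsTriangulated V (a + 1 + k) b R)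
    (htL : t ∉ L) (hone : sdrCount V (a + 1) k L = 1) (m : ℕ) :
    sdrCount V a (k + 1 + m) (insert t (L ∪ R)) = sdrCount V (a + 1 + k) m R := by
  have hcard := hL.card_add_one
  rw [← Finset.insert_union, sdrCount_union _ (k + 1), sdrCount_insert htL (by simp [ht]),
    hone, sdrCount_eq_zero (by omega : L.card < k + 1), add_zero, one_mul,
    show a + (k + 1) = a + 1 + k by omega]
  · intro x h₁ h₂ hx
    simp only [ht, Finset.mem_insert, Finset.mem_singleton] at hx
    omega
  · rw [Finset.card_insert_of_notMem htL]
    omega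
  · intro u hu x h₁ h₂ hx
    have := Finset.mem_Icc.1 (hR.subset_Icc hu hx)
    omega

theorem sdrCount_glue_right_succ (ht : V t = {a, a + 1 + k, b})
    (hL : IsTriangulated V a (a + 1 + k) L) (hR : IsTriangulated V (a + 1 + k) b R)
    (htR : t ∉ R) (hone : sdrCount V (a + 1) k L = 1) {m : ℕ} (hm : a + 1 + k + m < b) :
    sdrCount V (a + 1) (k + (m + 1)) (insert t (L ∪ R)) =
      sdrCount V (a + 1 + k + 1) m R + sdrCount V (a + 1 + k) (m + 1) R := by
  have hcard := hL.card_add_one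
  rw [← Finset.union_insert, sdrCount_union _ k, hone, one_mul,
    sdrCount_insert htR (by simp [ht])]
  · intro x h₁ h₂ hx
    simp only [ht, Finset.mem_insert, Finset.mem_singleton] at hx
    omega
  · omega
  · intro u hu x h₁ h₂ hx
    rcases Finset.mem_insert.1 hu with rfl | hu
    · simp only [ht, Finset.mem_insert, Finset.mem_singleton] at hx
      omega
    · have := Finset.mem_Icc.1 (hR.subset_Icc hu hx)
      omega

end Glue

theorem sdrCount_interior (h : IsTriangulated V a b X) :
    sdrCount V (a + 1) (b - a - 1) X = 1 := by
  induction h with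
  | edge a => simp [sdrCount]
  | @glue a c b t L R hac hcb ht hL hR htL htR hLR ihL ihR =>
    obtain ⟨k, rfl⟩ := Nat.exists_eq_add_of_le (Nat.succ_le_of_lt hac)
    obtain ⟨m, rfl⟩ := Nat.exists_eq_add_of_le (Nat.succ_le_of_lt hcb)
    simp only [Nat.succ_eq_add_one] at *
    rw [show a + 1 + k - a - 1 = k by omega] at ihL
    rw [show a + 1 + k + 1 + m - (a + 1 + k) - 1 = m by omega] at ihR
    have hcard := hR.card_add_one
    rw [show a + 1 + k + 1 + m - a - 1 = k + (m + 1) by omega,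
      sdrCount_glue_right_succ ht hL hR htR ihL (by omega), ihR, sdrCount_eq_zero (by omega)]

theorem sdrCount_det (h : IsTriangulated V a b X) {m : ℕ} (hm : a + m + 1 < b) :
    (sdrCount V a (m + 1) X : ℤ) * sdrCount V (a + 1) (m + 1) X -
      sdrCount V a (m + 2) X * sdrCount V (a + 1) m X = 1 := by
  induction h generalizing m with
  | edge a => omega
  | @glue a c b t L R hac hcb ht hL hR htL htR hLR ihL ihR =>
    have hone := hL.sdrCount_interior
    obtain ⟨k, rfl⟩ := Nat.exists_eq_add_of_le (Nat.succ_le_of_lt hac)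
    simp only [Nat.succ_eq_add_one] at *
    rw [show a + 1 + k - a - 1 = k by omega] at hone
    rcases lt_trichotomy m k with hmk | rfl | hmk
    · rw [sdrCount_glue_left_succ hcb ht hR htL hmk.le, sdrCount_glue_left hcb ht hR hmk,
        sdrCount_glue_left_succ hcb ht hR htL hmk, sdrCount_glue_left hcb ht hR hmk.le]
      push_cast
      linear_combination ihL (m := m) (by omega)
    · have h₁ := sdrCount_glue_right hcb ht hL hR htL hone 0
      have h₂ := sdrCount_glue_right hcb ht hL hR htL hone 1
      have h₃ := sdrCount_glue_right_succ ht hL hR htR hone (m := 0) (by omega)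
      rw [show m + 1 + 1 = m + 2 from rfl] at h₂
      simp only [add_zero, zero_add] at h₁ h₃
      rw [h₁, h₂, h₃, sdrCount_glue_left hcb ht hR le_rfl, hone]
      simp [sdrCount]
    · obtain ⟨l, rfl⟩ := Nat.exists_eq_add_of_le (Nat.succ_le_of_lt hmk)
      simp only [Nat.succ_eq_add_one] at *
      have h₁ := sdrCount_glue_right hcb ht hL hR htL hone (l + 1)
      have h₂ := sdrCount_glue_right hcb ht hL hR htL hone (l + 2)
      have h₃ := sdrCount_glue_right_succ ht hL hR htR hone (m := l) (by omega)
      have h₄ := sdrCount_glue_right_succ ht hL hR htR hone (m := l + 1) (by omega)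
      rw [show k + 1 + l + 1 = k + 1 + (l + 1) by omega,
        show k + 1 + l + 2 = k + 1 + (l + 2) by omega, h₁, h₂,
        show k + 1 + (l + 1) = k + (l + 1 + 1) by omega,
        show k + 1 + l = k + (l + 1) by omega, h₃, h₄]
      push_cast
      linear_combination ihR (m := l) (by omega)

end IsTriangulated

/-- A finite family of triangles on vertices `0, …, n - 1` which pairwise do not cross, and in
which every chord crossed by no triangle bounds a triangle on its inner side, dissects the
polygon. -/
theorem isTriangulated_of_noncrossing {n : ℕ} {T : Finset α} (hinj : Set.InjOn V T)
    (hcard : ∀ t ∈ T, (V t).card = 3)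
    (hcross : ∀ s ∈ T, ∀ t ∈ T, s ≠ t → ∀ p q r u, p < q → q < r → r < u →
      p ∈ V s → r ∈ V s → q ∈ V t → u ∈ V t → False)
    (hex : ∀ a b, a + 1 < b → b < n →
      (∀ s ∈ T, ∀ x ∈ V s, ∀ y ∈ V s, a < x → x < b → a ≤ y ∧ y ≤ b) →
      ∃ t ∈ T, ∃ c, a < c ∧ c < b ∧ V t = {a, c, b}) (a b : ℕ) (hab : a < b) (hb : b < n)
    (hchord : ∀ s ∈ T, ∀ x ∈ V s, ∀ y ∈ V s, a < x → x < b → a ≤ y ∧ y ≤ b) :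
    IsTriangulated V a b (T.filter fun t => V t ⊆ Finset.Icc a b) := by
  induction hd : b - a using Nat.strong_induction_on generalizing a b with
  | _ d ih =>
  have hthree {s : α} (hs : s ∈ T) {U : Finset ℕ} (hU : V s ⊆ U) : 3 ≤ U.card :=
    hcard s hs ▸ Finset.card_le_card hU
  rcases Nat.lt_or_ge (a + 1) b with hlt | hge
  · obtain ⟨t, ht, c, hac, hcb, hV⟩ := hex a b hlt hb hchord
    have hat : a ∈ V t := by simp [hV]
    have hbt : b ∈ V t := by simp [hV]
    have hct : c ∈ V t := by simp [hV]
    have hmem (x : ℕ) (hx : x ∈ V t) : x = a ∨ x = c ∨ x = b := by simpa [hV] using hx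
    have hL := ih (c - a) (by omega) a c hac (by omega) (by
      intro s hs x hx y hy h₁ h₂
      have hst : s ≠ t := by rintro rfl; have := hmem x hx; omega
      by_contra hcon
      rcases Nat.lt_or_ge y a with hya | hya
      · exact hcross s hs t ht hst y a x c hya h₁ h₂ hy hx hat hct
      · exact hcross t ht s hs hst.symm a x c y h₁ h₂ (by omega) hat hct hx hy) rfl
    have hR := ih (b - c) (by omega) c b hcb (by omega) (by
      intro s hs x hx y hy h₁ h₂
      have hst : s ≠ t := by rintro rfl; have := hmem x hx; omega
      by_contra hcon
      rcases Nat.lt_or_ge y c with hya | hya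
      · exact hcross s hs t ht hst y c x b hya h₁ h₂ hy hx hct hbt
      · exact hcross t ht s hs hst.symm c x b y h₁ h₂ (by omega) hct hbt hx hy) rfl
    have heq : T.filter (fun t => V t ⊆ Finset.Icc a b) =
        insert t (T.filter (fun t => V t ⊆ Finset.Icc a c) ∪
          T.filter fun t => V t ⊆ Finset.Icc c b) := by
      ext s
      simp only [Finset.mem_filter, Finset.mem_insert, Finset.mem_union]
      constructor
      · rintro ⟨hs, hsub⟩
        by_contra! hcon
        obtain ⟨hst, hsL, hsR⟩ := hcon
        obtain ⟨y, hy, hyc⟩ := Finset.not_subset.1 (hsL hs)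
        obtain ⟨z, hz, hzc⟩ := Finset.not_subset.1 (hsR hs)
        have hlow (x : ℕ) (hx : x ∈ V s) (hxc : x < c) : x = a := by
          by_contra hxa
          have h₁ := Finset.mem_Icc.1 (hsub hx)
          have h₂ := Finset.mem_Icc.1 (hsub hy)
          rw [Finset.mem_Icc] at hyc
          exact hcross t ht s hs (Ne.symm hst) a x c y (by omega) hxc (by omega) hat hct hx hy
        have hhigh (x : ℕ) (hx : x ∈ V s) (hxc : c < x) : x = b := by
          by_contra hxa
          have h₁ := Finset.mem_Icc.1 (hsub hx)
          have h₂ := Finset.mem_Icc.1 (hsub hz)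
          rw [Finset.mem_Icc] at hzc
          exact hcross s hs t ht hst z c x b (by omega) hxc (by omega) hz hx hct hbt
        refine hst (hinj hs ht (Finset.eq_of_subset_of_card_le (fun x hx => ?_) ?_))
        · rw [hV, Finset.mem_insert, Finset.mem_insert, Finset.mem_singleton]
          have h₁ := hlow x hx
          have h₂ := hhigh x hx
          omega
        · rw [hcard s hs, hcard t ht]
      · rintro (rfl | ⟨hs, hsub⟩ | ⟨hs, hsub⟩)
        · refine ⟨ht, fun x hx => Finset.mem_Icc.2 ?_⟩
          have := hmem x hx
          omega
        · exact ⟨hs, hsub.trans (Finset.Icc_subset_Icc_right hcb.le)⟩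
        · exact ⟨hs, hsub.trans (Finset.Icc_subset_Icc_left hac.le)⟩
    rw [heq]
    refine .glue hac hcb hV hL hR ?_ ?_ ?_
    · intro h
      have := Finset.mem_Icc.1 ((Finset.mem_filter.1 h).2 hbt)
      omega
    · intro h
      have := Finset.mem_Icc.1 ((Finset.mem_filter.1 h).2 hat)
      omega
    · rw [Finset.disjoint_left]
      intro s hs₁ hs₂
      have hs := (Finset.mem_filter.1 hs₁).1
      have hsub : V s ⊆ {c} := fun x hx => by
        have h₁ := Finset.mem_Icc.1 ((Finset.mem_filter.1 hs₁).2 hx)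
        have h₂ := Finset.mem_Icc.1 ((Finset.mem_filter.1 hs₂).2 hx)
        rw [Finset.mem_singleton]
        omega
      have := hthree hs hsub
      simp at this
  · obtain rfl : b = a + 1 := by omega
    rw [Finset.filter_eq_empty_iff.2]
    · exact .edge a
    · intro s hs hsub
      have := hthree hs hsub
      rw [Nat.card_Icc] at this
      omega

end Counting

section Geometry

/-- Twice the signed area of the triangle with vertices `p`, `q`, `r`. -/
def orient (p q r : ℝ × ℝ) : ℝ :=
  (q.1 - p.1) * (r.2 - p.2) - (r.1 - p.1) * (q.2 - p.2)

theorem orient_swap_left (p q r : ℝ × ℝ) : orient q p r = -orient p q r := by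
  unfold orient; ring

theorem orient_swap_right (p q r : ℝ × ℝ) : orient p r q = -orient p q r := by
  unfold orient; ring

theorem orient_circle_pos {x y z : ℝ} (hxy : x < y) (hyz : y < z)
    (hzx : z < x + 2 * Real.pi) :
    0 < orient (Real.cos x, Real.sin x) (Real.cos y, Real.sin y) (Real.cos z, Real.sin z) := by
  obtain ⟨u, rfl⟩ : ∃ u, y = x + 2 * u := ⟨(y - x) / 2, by ring⟩
  obtain ⟨v, rfl⟩ : ∃ v, z = x + 2 * u + 2 * v := ⟨(z - (x + 2 * u)) / 2, by ring⟩
  have key : orient (Real.cos x, Real.sin x) (Real.cos (x + 2 * u), Real.sin (x + 2 * u))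
      (Real.cos (x + 2 * u + 2 * v), Real.sin (x + 2 * u + 2 * v)) =
      4 * Real.sin u * Real.sin v * Real.sin (u + v) := by
    simp only [orient, Real.cos_add, Real.sin_add, Real.cos_two_mul, Real.sin_two_mul]
    have hx := Real.sin_sq_add_cos_sq x
    have hu := Real.sin_sq_add_cos_sq u
    have hv := Real.sin_sq_add_cos_sq v
    generalize Real.sin x = sx at *
    generalize Real.cos x = cx at *
    generalize Real.sin u = su at *
    generalize Real.cos u = cu at *
    generalize Real.sin v = sv at *
    generalize Real.cos v = cv at *
    grind
  rw [key]
  have hu := Real.sin_pos_of_pos_of_lt_pi (x := u) (by linarith) (by linarith)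
  have hv := Real.sin_pos_of_pos_of_lt_pi (x := v) (by linarith) (by linarith)
  have huv := Real.sin_pos_of_pos_of_lt_pi (x := u + v) (by linarith) (by linarith)
  positivity

theorem interior_convexHull_triangle_nonempty {p q r : ℝ × ℝ} (h : 0 < orient p q r) :
    (interior (convexHull ℝ {p, q, r})).Nonempty := by
  let U : Set (ℝ × ℝ) := {z | 0 < orient z q r ∧ 0 < orient p z r ∧ 0 < orient p q z}
  have hopen : IsOpen U := by
    simp only [U, orient, Set.ofPred_and]
    exact (isOpen_lt (by fun_prop) (by fun_prop)).inter
      ((isOpen_lt (by fun_prop) (by fun_prop)).inter (isOpen_lt (by fun_prop) (by fun_prop)))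
  have hsub : U ⊆ convexHull ℝ {p, q, r} := by
    rintro z ⟨h₁, h₂, h₃⟩
    have hz : z = (orient z q r / orient p q r) • p + (orient p z r / orient p q r) • q +
        (orient p q z / orient p q r) • r := by
      have h0 := h.ne'
      ext
      · simp only [Prod.fst_add, Prod.smul_fst, smul_eq_mul]
        field_simp
        unfold orient
        ring
      · simp only [Prod.snd_add, Prod.smul_snd, smul_eq_mul]
        field_simp
        unfold orient
        ring
    have hsum : orient z q r / orient p q r + orient p z r / orient p q r +
        orient p q z / orient p q r = 1 := by
      have h0 := h.ne'
      field_simp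
      unfold orient
      ring
    rw [hz]
    have := (convex_convexHull ℝ {p, q, r}).sum_mem (t := Finset.univ)
      (w := ![orient z q r / orient p q r, orient p z r / orient p q r,
        orient p q z / orient p q r]) (z := ![p, q, r])
      (by
        intro k _
        fin_cases k
        exacts [(div_pos h₁ h).le, (div_pos h₂ h).le, (div_pos h₃ h).le])
      (by simpa [Fin.sum_univ_three] using hsum)
      (by
        intro k _
        apply subset_convexHull
        fin_cases k <;> simp)
    simpa [Fin.sum_univ_three] using this
  refine ⟨(3⁻¹ : ℝ) • (p + q + r), interior_maximal hsub hopen ?_⟩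
  have e₁ : orient ((3⁻¹ : ℝ) • (p + q + r)) q r = 3⁻¹ * orient p q r := by
    simp [orient]; ring
  have e₂ : orient p ((3⁻¹ : ℝ) • (p + q + r)) r = 3⁻¹ * orient p q r := by
    simp [orient]; ring
  have e₃ : orient p q ((3⁻¹ : ℝ) • (p + q + r)) = 3⁻¹ * orient p q r := by
    simp [orient]; ring
  change 0 < orient _ q r ∧ 0 < orient p _ r ∧ 0 < orient p q _
  rw [e₁, e₂, e₃]
  refine ⟨?_, ?_, ?_⟩ <;> positivity

theorem not_crossing_of_disjoint_interior {A B : Set (ℝ × ℝ)} (hA : Convex ℝ A)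
    (hB : Convex ℝ B) (hA₀ : (interior A).Nonempty) (hB₀ : (interior B).Nonempty)
    (hAB : interior A ∩ interior B = ∅) {p q r u : ℝ × ℝ} (hp : p ∈ A) (hr : r ∈ A)
    (hq : q ∈ B) (hu : u ∈ B) (hpqr : 0 < orient p q r) (hpqu : 0 < orient p q u)
    (hpru : 0 < orient p r u) (hqru : 0 < orient q r u) : False := by
  obtain ⟨f, c, hfA, hfB⟩ := geometric_hahn_banach_open hA.interior isOpen_interior hB.interior
    (Set.disjoint_iff_inter_eq_empty.2 hAB)
  have hleA (x : ℝ × ℝ) (hx : x ∈ A) : f x ≤ c := by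
    have hx' := subset_closure hx
    rw [← hA.closure_interior_eq_closure_of_nonempty_interior hA₀] at hx'
    exact closure_minimal (fun y hy => (hfA y hy).le)
      (isClosed_le f.continuous continuous_const) hx'
  have hleB (x : ℝ × ℝ) (hx : x ∈ B) : c ≤ f x := by
    have hx' := subset_closure hx
    rw [← hB.closure_interior_eq_closure_of_nonempty_interior hB₀] at hx'
    exact closure_minimal hfB (isClosed_le continuous_const f.continuous) hx'
  have hf (x : ℝ × ℝ) : f x = x.1 * f (1, 0) + x.2 * f (0, 1) := by
    conv_lhs => rw [show x = x.1 • ((1 : ℝ), (0 : ℝ)) + x.2 • ((0 : ℝ), (1 : ℝ)) by ext <;> simp]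
    simp only [map_add, map_smul, smul_eq_mul]
  have hsum : orient q r u * (c - f p) + orient p r u * (f q - c) +
      orient p q u * (c - f r) + orient p q r * (f u - c) = 0 := by
    rw [hf p, hf q, hf r, hf u]
    unfold orient
    ring
  have h₁ := mul_nonneg hqru.le (sub_nonneg.2 (hleA p hp))
  have h₂ := mul_nonneg hpru.le (sub_nonneg.2 (hleB q hq))
  have h₃ := mul_nonneg hpqu.le (sub_nonneg.2 (hleA r hr))
  have h₄ := mul_nonneg hpqr.le (sub_nonneg.2 (hleB u hu))
  have ep : c - f p = 0 := by
    have : orient q r u * (c - f p) = 0 := by linarith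
    exact (mul_eq_zero.1 this).resolve_left hqru.ne'
  have eq : f q - c = 0 := by
    have : orient p r u * (f q - c) = 0 := by linarith
    exact (mul_eq_zero.1 this).resolve_left hpru.ne'
  have er : c - f r = 0 := by
    have : orient p q u * (c - f r) = 0 := by linarith
    exact (mul_eq_zero.1 this).resolve_left hpqu.ne'
  rw [hf] at ep eq er
  have hx : f (1, 0) = 0 := by
    have : orient p q r * f (1, 0) = 0 := by
      unfold orient
      linear_combination (r.2 - p.2) * (eq + ep) + (q.2 - p.2) * (er - ep)
    exact (mul_eq_zero.1 this).resolve_left hpqr.ne'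
  have hy : f (0, 1) = 0 := by
    have : orient p q r * f (0, 1) = 0 := by
      unfold orient
      linear_combination -(r.1 - p.1) * (eq + ep) - (q.1 - p.1) * (er - ep)
    exact (mul_eq_zero.1 this).resolve_left hpqr.ne'
  obtain ⟨x, hxA⟩ := hA₀
  obtain ⟨y, hyB⟩ := hB₀
  have h₅ := hfA x hxA
  have h₆ := hfB y hyB
  rw [hf, hx, hy] at h₅ h₆
  linarith

/-- If finitely many points other than `p` and `q` lie strictly on one side of the line through
`p` and `q`, then their convex hull with some of `p`, `q` added contains the midpoint of `p` and
`q` only if both were added. -/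
theorem mem_of_midpoint_mem_convexHull {p q : ℝ × ℝ} (hpq : p ≠ q) {s : Finset (ℝ × ℝ)}
    (hs : ∀ z ∈ s, z = p ∨ z = q ∨ 0 < orient p z q)
    (hm : midpoint ℝ p q ∈ convexHull ℝ (s : Set (ℝ × ℝ))) : p ∈ s ∧ q ∈ s := by
  obtain ⟨c, hc, hsum, hmid⟩ := Finset.mem_convexHull'.1 hm
  have hx : ∑ z ∈ s, c z * z.1 = (p.1 + q.1) / 2 := by
    have := congrArg Prod.fst hmid
    rw [Prod.fst_sum] at this
    simp only [Prod.smul_fst, smul_eq_mul] at this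
    rw [this, midpoint_eq_smul_add]
    simp; ring
  have hy : ∑ z ∈ s, c z * z.2 = (p.2 + q.2) / 2 := by
    have := congrArg Prod.snd hmid
    rw [Prod.snd_sum] at this
    simp only [Prod.smul_snd, smul_eq_mul] at this
    rw [this, midpoint_eq_smul_add]
    simp; ring
  have horient : ∑ z ∈ s, c z * orient p z q = 0 := by
    have : ∑ z ∈ s, c z * orient p z q = (∑ z ∈ s, c z * z.1) * (q.2 - p.2) -
        (∑ z ∈ s, c z * z.2) * (q.1 - p.1) +
        (∑ z ∈ s, c z) * (p.2 * (q.1 - p.1) - p.1 * (q.2 - p.2)) := by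
      rw [Finset.sum_mul, Finset.sum_mul, Finset.sum_mul, ← Finset.sum_sub_distrib,
        ← Finset.sum_add_distrib]
      refine Finset.sum_congr rfl fun z _ => ?_
      unfold orient
      ring
    rw [this, hx, hy, hsum]
    ring
  have hnonneg (z : ℝ × ℝ) (hz : z ∈ s) : 0 ≤ c z * orient p z q := by
    refine mul_nonneg (hc z hz) ?_
    rcases hs z hz with rfl | rfl | h
    · simp [orient]
    · exact (by unfold orient; ring : orient p z z = 0).ge
    · exact h.le
  have hzero (z : ℝ × ℝ) (hz : z ∈ s) (hzp : z ≠ p) (hzq : z ≠ q) : c z = 0 := by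
    have := (Finset.sum_eq_zero_iff_of_nonneg hnonneg).1 horient z hz
    have hpos := ((hs z hz).resolve_left hzp).resolve_left hzq
    exact (mul_eq_zero.1 this).resolve_right hpos.ne'
  have hsingle (x : ℝ × ℝ) (hx : ∀ z ∈ s, z ≠ x → c z = 0) : midpoint ℝ p q = x := by
    have hxs : x ∈ s := by
      by_contra hxs
      rw [Finset.sum_eq_zero fun z hz => hx z hz fun h => hxs (h ▸ hz)] at hsum
      exact zero_ne_one hsum
    rw [Finset.sum_eq_single_of_mem x hxs hx] at hsum
    rw [← hmid, Finset.sum_eq_single_of_mem x hxs fun z hz hzx => by rw [hx z hz hzx, zero_smul],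
      hsum, one_smul]
  constructor
  · by_contra hp
    have := hsingle q fun z hz hzq => hzero z hz (fun h => hp (h ▸ hz)) hzq
    exact hpq (by simpa using this)
  · by_contra hq
    have := hsingle p fun z hz hzp => hzero z hz hzp (fun h => hq (h ▸ hz))
    exact hpq (by simpa [eq_comm] using this)

/-- If finitely many polytopes cover a convex set, then for points `m`, `d` of it one of the
polytopes contains `m` together with a later point of the ray from `m` through `d`. -/
theorem exists_mem_convexHull_of_cover {α : Type*} {T : Finset α} {S : α → Finset (ℝ × ℝ)}
    {K : Set (ℝ × ℝ)} (hK : Convex ℝ K)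
    (hcover : ∀ z ∈ K, ∃ t ∈ T, z ∈ convexHull ℝ (S t : Set (ℝ × ℝ)))
    {m d : ℝ × ℝ} (hm : m ∈ K) (hd : d ∈ K) :
    ∃ t ∈ T, m ∈ convexHull ℝ (S t : Set (ℝ × ℝ)) ∧
      ∃ ε : ℝ, 0 < ε ∧ AffineMap.lineMap m d ε ∈ convexHull ℝ (S t : Set (ℝ × ℝ)) := by
  have hev : ∀ᶠ ε : ℝ in nhdsWithin 0 (Set.Ioi 0), ∀ t ∈ T,
      AffineMap.lineMap m d ε ∈ convexHull ℝ (S t : Set (ℝ × ℝ)) →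
        m ∈ convexHull ℝ (S t : Set (ℝ × ℝ)) := by
    refine (Filter.eventually_all_finset T).2 fun t _ => ?_
    by_cases hmt : m ∈ convexHull ℝ (S t : Set (ℝ × ℝ))
    · exact Filter.Eventually.of_forall fun _ _ => hmt
    · have hclosed := (S t).finite_toSet.isClosed_convexHull ℝ
      have hcont : Filter.Tendsto (fun ε : ℝ => AffineMap.lineMap m d ε)
          (nhdsWithin 0 (Set.Ioi 0)) (nhds m) := by
        have : Continuous fun ε : ℝ => AffineMap.lineMap m d ε := AffineMap.lineMap_continuous
        simpa using (this.tendsto 0).mono_left nhdsWithin_le_nhds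
      filter_upwards [hcont.eventually (hclosed.isOpen_compl.mem_nhds hmt)] with ε hε h
      exact absurd h hε
  obtain ⟨ε, hε, hε₀, hε₁⟩ := (hev.and (Ioo_mem_nhdsGT one_pos)).exists
  obtain ⟨t, ht, hmem⟩ := hcover _ (hK.lineMap_mem hm hd ⟨hε₀.le, hε₁.le⟩)
  exact ⟨t, ht, hε t ht hmem, ε, hε₀, hmem⟩

/-- The points `w 0, …, w (n - 1)` are the vertices of a strictly convex polygon in
counterclockwise order. -/
def IsConvexPolygon (n : ℕ) (w : ℕ → ℝ × ℝ) : Prop :=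
  ∀ k l m, k < l → l < m → m < n → 0 < orient (w k) (w l) (w m)

namespace IsConvexPolygon

variable {n : ℕ} {w : ℕ → ℝ × ℝ}

theorem interior_convexHull_nonempty (hw : IsConvexPolygon n w) {s : Finset ℕ}
    (hs : s.card = 3) (hsn : ∀ k ∈ s, k < n) : (interior (convexHull ℝ (w '' s))).Nonempty := by
  have hmem (k : Fin 3) : s.orderEmbOfFin hs k ∈ s := s.orderEmbOfFin_mem hs k
  have hlt {k l : Fin 3} (h : k < l) : s.orderEmbOfFin hs k < s.orderEmbOfFin hs l :=
    (s.orderEmbOfFin hs).strictMono h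
  refine (interior_convexHull_triangle_nonempty (hw _ _ _ (hlt (k := 0) (l := 1) (by decide))
    (hlt (k := 1) (l := 2) (by decide)) (hsn _ (hmem 2)))).mono
    (interior_mono (convexHull_mono ?_))
  rintro z (rfl | rfl | rfl) <;> exact Set.mem_image_of_mem w (hmem _)

theorem ne (hw : IsConvexPolygon n w) {a b : ℕ} (hab : a + 1 < b) (hb : b < n) :
    w a ≠ w b := by
  intro h
  have := hw a (a + 1) b (by omega) hab hb
  rw [h] at this
  simp [orient] at this

theorem not_crossing (hw : IsConvexPolygon n w) {s t : Finset ℕ} (hs : s.card = 3)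
    (ht : t.card = 3) (hsn : ∀ k ∈ s, k < n) (htn : ∀ k ∈ t, k < n)
    (hst : interior (convexHull ℝ (w '' s)) ∩ interior (convexHull ℝ (w '' t)) = ∅)
    {p q r u : ℕ} (hpq : p < q) (hqr : q < r) (hru : r < u) (hp : p ∈ s) (hr : r ∈ s)
    (hq : q ∈ t) (hu : u ∈ t) : False :=
  have hun := htn u hu
  have hrn := hsn r hr
  not_crossing_of_disjoint_interior (convex_convexHull ℝ _) (convex_convexHull ℝ _)
    (hw.interior_convexHull_nonempty hs hsn) (hw.interior_convexHull_nonempty ht htn) hst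
    (subset_convexHull ℝ _ (Set.mem_image_of_mem w hp))
    (subset_convexHull ℝ _ (Set.mem_image_of_mem w hr))
    (subset_convexHull ℝ _ (Set.mem_image_of_mem w hq))
    (subset_convexHull ℝ _ (Set.mem_image_of_mem w hu))
    (hw _ _ _ hpq hqr hrn) (hw _ _ _ hpq (hqr.trans hru) hun)
    (hw _ _ _ (hpq.trans hqr) hru hun) (hw _ _ _ hqr hru hun)

theorem exists_triangle (hw : IsConvexPolygon n w) {α : Type*} {T : Finset α}
    {V : α → Finset ℕ} (hcard : ∀ t ∈ T, (V t).card = 3) (hVn : ∀ t ∈ T, ∀ k ∈ V t, k < n)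
    (hcover : ∀ z ∈ convexHull ℝ (w '' Set.Iio n), ∃ t ∈ T, z ∈ convexHull ℝ (w '' V t))
    {a b : ℕ} (hab : a + 1 < b) (hb : b < n)
    (hchord : ∀ s ∈ T, ∀ x ∈ V s, ∀ y ∈ V s, a < x → x < b → a ≤ y ∧ y ≤ b) :
    ∃ t ∈ T, ∃ c, a < c ∧ c < b ∧ V t = {a, c, b} := by
  have hK (k : ℕ) (hk : k < n) : w k ∈ convexHull ℝ (w '' Set.Iio n) :=
    subset_convexHull ℝ _ (Set.mem_image_of_mem w hk)
  have hne := hw.ne hab hb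
  obtain ⟨t, ht, hm, ε, hε, hmem⟩ := exists_mem_convexHull_of_cover (T := T)
    (S := fun t => (V t).image w) (convex_convexHull ℝ (w '' Set.Iio n))
    (by simpa only [Finset.coe_image] using hcover)
    ((convex_convexHull ℝ (w '' Set.Iio n)).midpoint_mem (hK a (by omega)) (hK b hb))
    (hK (a + 1) (by omega))
  have hin (k : ℕ) (hak : a < k) (hkb : k < b) : 0 < orient (w a) (w k) (w b) :=
    hw a k b hak hkb hb
  have hout (k : ℕ) (hk : k < n) (hkab : k ≤ a ∨ b ≤ k) : orient (w a) (w k) (w b) ≤ 0 := by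
    rcases hkab with h | h
    · rcases h.eq_or_lt with rfl | h
      · simp [orient]
      · rw [orient_swap_left]
        exact neg_nonpos.2 (hw k a b h (by omega) hb).le
    · rcases h.eq_or_lt with rfl | h
      · exact (by unfold orient; ring : orient (w a) (w b) (w b) = 0).le
      · rw [orient_swap_right]
        exact neg_nonpos.2 (hw a b k (by omega) h hk).le
  obtain ⟨x, hx, hax, hxb⟩ : ∃ x ∈ V t, a < x ∧ x < b := by
    by_contra! hcon
    have hconv : Convex ℝ {z : ℝ × ℝ | orient (w a) z (w b) ≤ 0} := by
      intro y hy z hz α β hα hβ hαβ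
      have : orient (w a) (α • y + β • z) (w b) =
          α * orient (w a) y (w b) + β * orient (w a) z (w b) := by
        obtain rfl : β = 1 - α := by linarith
        simp only [orient, Prod.fst_add, Prod.snd_add, Prod.smul_fst, Prod.smul_snd, smul_eq_mul]
        ring
      change orient (w a) (α • y + β • z) (w b) ≤ 0
      rw [this]
      exact add_nonpos (mul_nonpos_of_nonneg_of_nonpos hα hy)
        (mul_nonpos_of_nonneg_of_nonpos hβ hz)
    have hle := convexHull_min (s := ((V t).image w : Set (ℝ × ℝ))) (by
      rw [Finset.coe_image]
      rintro _ ⟨k, hk, rfl⟩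
      refine hout k (hVn t ht k hk) ?_
      have := hcon k hk
      omega) hconv hmem
    have hval : orient (w a) (AffineMap.lineMap (midpoint ℝ (w a) (w b)) (w (a + 1)) ε) (w b) =
        ε * orient (w a) (w (a + 1)) (w b) := by
      rw [AffineMap.lineMap_apply_module, midpoint_eq_smul_add]
      simp [orient]
      ring
    have hpos := mul_pos hε (hin (a + 1) (by omega) hab)
    rw [← hval] at hpos
    exact hpos.not_ge hle
  have hVab (y : ℕ) (hy : y ∈ V t) : a ≤ y ∧ y ≤ b := hchord t ht x hx y hy hax hxb
  have hside (y : ℕ) (hy : y ∈ V t) :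
      y = a ∨ y = b ∨ 0 < orient (w a) (w y) (w b) := by
    have h := hVab y hy
    by_cases ha : y = a
    · exact Or.inl ha
    by_cases hb' : y = b
    · exact Or.inr (Or.inl hb')
    exact Or.inr (Or.inr (hin y (by omega) (by omega)))
  have hends := mem_of_midpoint_mem_convexHull hne (s := (V t).image w) (by
    intro z hz
    obtain ⟨y, hy, rfl⟩ := Finset.mem_image.1 hz
    exact (hside y hy).imp (congrArg w) (Or.imp_left (congrArg w))) hm
  have ha : a ∈ V t := by
    obtain ⟨y, hy, hya⟩ := Finset.mem_image.1 hends.1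
    rcases hside y hy with rfl | rfl | h
    · exact hy
    · exact absurd hya.symm hne
    · rw [hya] at h
      simp [orient] at h
  have hb' : b ∈ V t := by
    obtain ⟨y, hy, hyb⟩ := Finset.mem_image.1 hends.2
    rcases hside y hy with rfl | rfl | h
    · exact absurd hyb hne
    · exact hy
    · rw [hyb] at h
      exact absurd h (by unfold orient; ring_nf; exact lt_irrefl 0)
  refine ⟨t, ht, x, hax, hxb, (Finset.eq_of_subset_of_card_le (fun y hy => ?_) ?_).symm⟩
  · simp only [Finset.mem_insert, Finset.mem_singleton] at hy
    rcases hy with rfl | rfl | rfl <;> assumption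
  · rw [hcard t ht, Finset.card_eq_three.2 ⟨a, x, b, by omega, by omega, by omega, rfl⟩]

end IsConvexPolygon

end Geometry

section Polygon

variable {n : ℕ} [NeZero n]

theorem vtx_natCast (m : ℕ) :
    vtx n (m : ZMod n) =
      (Real.cos (2 * Real.pi * m / n), Real.sin (2 * Real.pi * m / n)) := by
  have hn : (n : ℝ) ≠ 0 := Nat.cast_ne_zero.2 (NeZero.ne n)
  have hm : 2 * Real.pi * (m : ℝ) / n =
      2 * Real.pi * ((m % n : ℕ) : ℝ) / n + ((m / n : ℕ) : ℝ) * (2 * Real.pi) := by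
    have : (m : ℝ) = ((m % n : ℕ) : ℝ) + n * ((m / n : ℕ) : ℝ) := by
      exact_mod_cast (Nat.mod_add_div m n).symm
    rw [this]
    field_simp
  rw [vtx, ZMod.val_natCast, hm, Real.cos_add_nat_mul_two_pi, Real.sin_add_nat_mul_two_pi]

theorem isConvexPolygon_vtx (a : ZMod n) : IsConvexPolygon n fun k => vtx n (a + k) := by
  have hn : (0 : ℝ) < n := Nat.cast_pos.2 (NeZero.pos n)
  have hvtx (k : ℕ) : vtx n (a + k) = (Real.cos (2 * Real.pi * ((a.val + k : ℕ) : ℝ) / n),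
      Real.sin (2 * Real.pi * ((a.val + k : ℕ) : ℝ) / n)) := by
    rw [← vtx_natCast, Nat.cast_add, ZMod.natCast_zmod_val]
  intro k l m hkl hlm hmn
  simp only [hvtx]
  have hkl' : ((a.val + k : ℕ) : ℝ) < ((a.val + l : ℕ) : ℝ) := by
    exact_mod_cast Nat.add_lt_add_left hkl _
  have hlm' : ((a.val + l : ℕ) : ℝ) < ((a.val + m : ℕ) : ℝ) := by
    exact_mod_cast Nat.add_lt_add_left hlm _
  have hmk : ((a.val + m : ℕ) : ℝ) < ((a.val + k : ℕ) : ℝ) + n := by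
    exact_mod_cast (by omega : a.val + m < a.val + k + n)
  have hpi := Real.pi_pos
  apply orient_circle_pos
  · gcongr
  · gcongr
  · rw [div_lt_iff₀ hn, add_mul, div_mul_cancel₀ _ hn.ne', ← mul_add]
    gcongr

/-- The positions of the vertices in `t` when the polygon is traversed from `a`. -/
def positions (a : ZMod n) (t : Finset (ZMod n)) : Finset ℕ :=
  t.image fun x => (x - a).val

theorem mem_positions {a : ZMod n} {t : Finset (ZMod n)} {k : ℕ} (hk : k < n) :
    k ∈ positions a t ↔ a + k ∈ t := by
  rw [positions, Finset.mem_image]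
  constructor
  · rintro ⟨x, hx, rfl⟩
    simpa using hx
  · intro h
    exact ⟨_, h, by simp [ZMod.val_natCast_of_lt hk]⟩

theorem lt_of_mem_positions {a : ZMod n} {t : Finset (ZMod n)} {k : ℕ}
    (hk : k ∈ positions a t) : k < n := by
  obtain ⟨x, -, rfl⟩ := Finset.mem_image.1 hk
  exact ZMod.val_lt _

theorem injective_sub_val (a : ZMod n) : Function.Injective fun x : ZMod n => (x - a).val :=
  (ZMod.val_injective n).comp sub_left_injective

theorem cellHull_eq_positions (a : ZMod n) (t : Finset (ZMod n)) :
    cellHull n t = convexHull ℝ ((fun k : ℕ => vtx n (a + k)) '' positions a t) := by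
  rw [cellHull, positions, Finset.coe_image, Set.image_image]
  simp

theorem image_vtx_Iio (a : ZMod n) :
    (fun k : ℕ => vtx n (a + k)) '' Set.Iio n = Set.range (vtx n) := by
  ext z
  constructor
  · rintro ⟨k, -, rfl⟩
    exact ⟨_, rfl⟩
  · rintro ⟨x, rfl⟩
    exact ⟨(x - a).val, ZMod.val_lt _, by simp⟩

theorem IsDAngulation.isTriangulated {T : Finset (Finset (ZMod n))} (hT : IsDAngulation n 3 T)
    (hn : 3 ≤ n) (a : ZMod n) : IsTriangulated (positions a) 0 (n - 1) T := by
  obtain ⟨hcard, hcover, hdisj⟩ := hT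
  have hw := isConvexPolygon_vtx (n := n) a
  have hcard' (t) (ht : t ∈ T) : (positions a t).card = 3 := by
    rw [positions, Finset.card_image_of_injective _ (injective_sub_val a), hcard t ht]
  have hlt (t) (_ : t ∈ T) (k) (hk : k ∈ positions a t) : k < n := lt_of_mem_positions hk
  have h := isTriangulated_of_noncrossing (V := positions a) (n := n) (T := T)
    (Finset.image_injective (injective_sub_val a)).injOn hcard'
    (fun s hs t ht hst p q r u hpq hqr hru hp hr hq hu =>
      hw.not_crossing (hcard' s hs) (hcard' t ht) (hlt s hs) (hlt t ht)
        (by simpa only [cellHull_eq_positions a] using hdisj s hs t ht hst)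
        hpq hqr hru hp hr hq hu)
    (fun b c hbc hc hchord => hw.exists_triangle hcard' hlt (fun z hz => by
      rw [image_vtx_Iio, ← hcover] at hz
      simpa only [Set.mem_iUnion, exists_prop, cellHull_eq_positions a] using hz) hbc hc hchord)
    0 (n - 1) (by omega) (by omega) fun s hs x _ y hy _ _ => by
      have := hlt s hs y hy
      omega
  rwa [Finset.filter_true_of_mem fun t ht k hk => Finset.mem_Icc.2 (by
    have := hlt t ht k hk
    omega)] at h

theorem dPathCount_eq_sdrCount (T : Finset (Finset (ZMod n))) {a i j : ZMod n} {s : ℕ}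
    (hi : i + 1 = a + s) (hs : s + pathLen n i j ≤ n) :
    dPathCount n 3 T i j = sdrCount (positions a) s (pathLen n i j) T := by
  rw [← sdrCount_eq_card]
  have hmem (k : Fin (pathLen n i j)) (t : Finset (ZMod n)) :
      s + (k : ℕ) ∈ positions a t ↔ i + 1 + ((k : ℕ) : ZMod n) ∈ t := by
    rw [mem_positions (by omega), hi, Nat.cast_add, add_assoc]
  have hinj (q : Fin (pathLen n i j) → {c // c ∈ T}) :
      (∀ c ∈ T, (Finset.univ.filter (fun k => (q k : Finset (ZMod n)) = c)).card ≤ 3 - 2) ↔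
        Function.Injective fun k => (q k : Finset (ZMod n)) := by
    constructor
    · intro h k l hkl
      exact Finset.card_le_one.1 (h (q k) (q k).2) k (by simp) l (by simpa using hkl.symm)
    · intro h c _
      refine Finset.card_le_one.2 fun k hk l hl => h ?_
      exact (Finset.mem_filter.1 hk).2.trans (Finset.mem_filter.1 hl).2.symm
  exact Nat.card_congr
    { toFun := fun q => ⟨fun k => q.1 k,
        fun k => ⟨(q.1 k).2, (hmem k _).2 (q.2.1 k)⟩, (hinj q.1).1 q.2.2⟩
      invFun := fun q => ⟨fun k => ⟨q.1 k, (q.2.1 k).1⟩,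
        fun k => (hmem k _).1 (q.2.1 k).2, (hinj _).2 q.2.2⟩
      left_inv := fun _ => rfl
      right_inv := fun _ => rfl }

end Polygon

/-- For a triangulation `T` of the convex `n`-gon, every adjacent `2×2` minor
`d(e,f)` for distinct boundary edges `e = (i,i+1)`, `f = (j,j+1)` equals `1`;
hence the associated array is a Conway–Coxeter frieze pattern. -/
theorem triangulation_hinge_det_one (n : ℕ) (hn : 3 ≤ n)
    (T : Finset (Finset (ZMod n))) (hT : IsDAngulation n 3 T) (i j : ZMod n)
    (hij : i ≠ j) :
    (dPathCount n 3 T i j : ℤ) * dPathCount n 3 T (i + 1) (j + 1)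
      - dPathCount n 3 T i (j + 1) * dPathCount n 3 T (i + 1) j = 1 := by
  have : NeZero n := ⟨by omega⟩
  have htri := hT.isTriangulated hn (i + 1)
  obtain ⟨l, hl, hj⟩ : ∃ l : ℕ, l < n ∧ j = i + 1 + l :=
    ⟨(j - (i + 1)).val, ZMod.val_lt _, by simp⟩
  have hl' : l + 1 < n := by
    refine lt_of_le_of_ne hl fun h => hij ?_
    have h0 : ((l + 1 : ℕ) : ZMod n) = 0 := by rw [h, ZMod.natCast_self]
    rw [hj, add_assoc, add_comm 1, ← Nat.cast_add_one, h0, add_zero]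
  have h₁ : pathLen n i j = l := by
    rw [pathLen, hj, show i + 1 + (l : ZMod n) - i - 1 = l by ring, ZMod.val_natCast_of_lt hl]
  have h₂ : pathLen n (i + 1) (j + 1) = l := by
    rw [pathLen, hj, show i + 1 + (l : ZMod n) + 1 - (i + 1) - 1 = l by ring,
      ZMod.val_natCast_of_lt hl]
  have h₃ : pathLen n i (j + 1) = l + 1 := by
    rw [pathLen, hj, show i + 1 + (l : ZMod n) + 1 - i - 1 = ((l + 1 : ℕ) : ZMod n) by
      push_cast; ring, ZMod.val_natCast_of_lt hl']
  rw [dPathCount_eq_sdrCount T (a := i + 1) (s := 0) (by simp) (by omega), h₁,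
    dPathCount_eq_sdrCount T (a := i + 1) (s := 1) (by simp) (by omega), h₂,
    dPathCount_eq_sdrCount T (a := i + 1) (s := 0) (by simp) (by omega), h₃]
  cases l with
  | zero =>
    have h₄ : pathLen n (i + 1) j = n - 1 := by
      rw [pathLen, hj, show i + 1 + ((0 : ℕ) : ZMod n) - (i + 1) - 1 = ((n - 1 : ℕ) : ZMod n) by
        rw [Nat.cast_sub (by omega)]; simp, ZMod.val_natCast_of_lt (by omega)]
    have hcard := htri.card_add_one
    rw [dPathCount_eq_sdrCount T (a := i + 1) (s := 1) (by simp) (by omega), h₄,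
      sdrCount_eq_zero (k := n - 1) (by omega)]
    simp [sdrCount]
  | succ m =>
    have h₄ : pathLen n (i + 1) j = m := by
      rw [pathLen, hj, show i + 1 + ((m + 1 : ℕ) : ZMod n) - (i + 1) - 1 = m by
        push_cast; ring, ZMod.val_natCast_of_lt (by omega)]
    rw [dPathCount_eq_sdrCount T (a := i + 1) (s := 1) (by simp) (by omega), h₄]
    exact htri.sdrCount_det (by omega)
end
end

section
/- Let T be a d-angulation of a convex (n+d−2)-gon in which the diagonal between vertices 1 and n cuts off a boundary d-gon α with vertices 1, n, n+1, …, n+d−2, and let T' be the induced d-angulation of the n-gon on vertices 1,…,n. Then for all vertices i ≤ j in {1,…,n}, the d-path counts satisfy m_{i,j} = m'_{i,j} and m_{j,i} = m'_{j,i}; for i ∈ {1,…,n} and j ∈ {n+1,…,n+d−2}, m_{i,j} = m'_{i,n} + m'_{i,1} and m_{j,i} = m'_{1,i} + m'_{n,i}; and for i, j ∈ {n+1,…,n+d−2} with i ≠ j, m_{i,j} = 1. -/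
noncomputable section

/-- Twice the signed area of the triangle `p q r`. -/
def signedArea (p q r : ℝ × ℝ) : ℝ :=
  (q.1 - p.1) * (r.2 - p.2) - (q.2 - p.2) * (r.1 - p.1)

lemma signedArea_circle (x y z : ℝ) :
    signedArea (Real.cos x, Real.sin x) (Real.cos y, Real.sin y) (Real.cos z, Real.sin z) =
      4 * Real.sin ((y - x) / 2) * Real.sin ((z - y) / 2) * Real.sin ((z - x) / 2) := by
  obtain ⟨u, rfl⟩ : ∃ u, y = x + 2 * u := ⟨(y - x) / 2, by ring⟩
  obtain ⟨w, rfl⟩ : ∃ w, z = x + 2 * u + 2 * w := ⟨(z - (x + 2 * u)) / 2, by ring⟩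
  have e₁ : (x + 2 * u - x) / 2 = u := by ring
  have e₂ : (x + 2 * u + 2 * w - (x + 2 * u)) / 2 = w := by ring
  have e₃ : (x + 2 * u + 2 * w - x) / 2 = u + w := by ring
  have hx := Real.sin_sq_add_cos_sq x
  have hu := Real.sin_sq_add_cos_sq u
  have hw := Real.sin_sq_add_cos_sq w
  have hsum : signedArea (Real.cos x, Real.sin x)
      (Real.cos (x + 2 * u), Real.sin (x + 2 * u))
      (Real.cos (x + 2 * u + 2 * w), Real.sin (x + 2 * u + 2 * w)) =
      Real.sin (2 * u) + Real.sin (2 * w) - Real.sin (2 * u + 2 * w) := by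
    have h₁ := Real.sin_sub (x + 2 * u) x
    have h₂ := Real.sin_sub (x + 2 * u + 2 * w) (x + 2 * u)
    have h₃ := Real.sin_sub (x + 2 * u + 2 * w) x
    rw [show x + 2 * u - x = 2 * u by ring] at h₁
    rw [show x + 2 * u + 2 * w - (x + 2 * u) = 2 * w by ring] at h₂
    rw [show x + 2 * u + 2 * w - x = 2 * u + 2 * w by ring] at h₃
    rw [h₁, h₂, h₃, signedArea]
    ring
  rw [hsum, e₁, e₂, e₃, Real.sin_add (2 * u), Real.sin_two_mul, Real.sin_two_mul,
    Real.cos_two_mul, Real.cos_two_mul, Real.sin_add]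
  linear_combination (-4 * Real.sin u * Real.cos u) * hw + (-4 * Real.sin w * Real.cos w) * hu

lemma signedArea_vtx_pos {N : ℕ} [NeZero N] {i j k : ZMod N} (hij : i.val < j.val)
    (hjk : j.val < k.val) : 0 < signedArea (vtx N i) (vtx N j) (vtx N k) := by
  have hN : (0 : ℝ) < N := by exact_mod_cast Nat.pos_of_ne_zero (NeZero.ne N)
  have key : ∀ a b : ZMod N, a.val < b.val →
      0 < Real.sin ((2 * Real.pi * b.val / N - 2 * Real.pi * a.val / N) / 2) := by
    intro a b hab
    have hb : (b.val : ℝ) < N := by exact_mod_cast ZMod.val_lt b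
    have hab' : (a.val : ℝ) < b.val := by exact_mod_cast hab
    have ha : (0 : ℝ) ≤ a.val := Nat.cast_nonneg _
    have e : (2 * Real.pi * b.val / N - 2 * Real.pi * a.val / N) / 2
        = Real.pi * ((b.val - a.val) / N) := by ring
    rw [e]
    apply Real.sin_pos_of_pos_of_lt_pi
    · exact mul_pos Real.pi_pos (div_pos (by linarith) hN)
    · have : ((b.val : ℝ) - a.val) / N < 1 := by rw [div_lt_one hN]; linarith
      nlinarith [Real.pi_pos]
  rw [vtx, vtx, vtx, signedArea_circle]
  have h₁ := key i j hij
  have h₂ := key j k hjk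
  have h₃ := key i k (hij.trans hjk)
  positivity

lemma signedArea_rotate (p q r : ℝ × ℝ) : signedArea p q r = signedArea q r p := by
  unfold signedArea; ring

lemma signedArea_swap (p q r : ℝ × ℝ) : signedArea p q r = -signedArea p r q := by
  unfold signedArea; ring

lemma apply_prod_eq (f : StrongDual ℝ (ℝ × ℝ)) (p : ℝ × ℝ) :
    f p = p.1 * f (1, 0) + p.2 * f (0, 1) := by
  conv_lhs => rw [show p = p.1 • ((1 : ℝ), (0 : ℝ)) + p.2 • ((0 : ℝ), (1 : ℝ)) by ext <;> simp]
  rw [map_add, map_smul, map_smul]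
  simp

/-- A linear functional that is constant on the vertices of a nondegenerate triangle is zero. -/
lemma eq_zero_of_constant_on_triangle (f : StrongDual ℝ (ℝ × ℝ)) {p q r : ℝ × ℝ} {s : ℝ}
    (hA : signedArea p q r ≠ 0) (hp : f p = s) (hq : f q = s) (hr : f r = s) (x : ℝ × ℝ) :
    f x = 0 := by
  rw [apply_prod_eq] at hp hq hr ⊢
  have h₁ : f (1, 0) = 0 := by
    apply (mul_eq_zero.mp _).resolve_left hA
    unfold signedArea
    linear_combination (r.2 - p.2) * (hq - hp) - (q.2 - p.2) * (hr - hp)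
  have h₂ : f (0, 1) = 0 := by
    apply (mul_eq_zero.mp _).resolve_left hA
    unfold signedArea
    linear_combination (q.1 - p.1) * (hr - hp) - (r.1 - p.1) * (hq - hp)
  simp [h₁, h₂]

lemma interior_convexHull_nonempty_of_signedArea {s : Set (ℝ × ℝ)} {p q r : ℝ × ℝ}
    (hp : p ∈ s) (hq : q ∈ s) (hr : r ∈ s) (hA : signedArea p q r ≠ 0) :
    (interior (convexHull ℝ s)).Nonempty := by
  rw [interior_convexHull_nonempty_iff_affineSpan_eq_top, eq_top_iff]
  intro x _
  have hmem : ∀ y ∈ s, y ∈ affineSpan ℝ s := fun y hy => subset_affineSpan ℝ s hy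
  have h := AffineSubspace.vadd_mem_of_mem_direction
    (Submodule.add_mem _
      (Submodule.smul_mem _ (signedArea p x r / signedArea p q r)
        (AffineSubspace.vsub_mem_direction (hmem q hq) (hmem p hp)))
      (Submodule.smul_mem _ (signedArea p q x / signedArea p q r)
        (AffineSubspace.vsub_mem_direction (hmem r hr) (hmem p hp)))) (hmem p hp)
  convert h using 1
  ext
  · simp
    field_simp
    unfold signedArea
    ring
  · simp
    field_simp
    unfold signedArea
    ring

lemma signedArea_vtx_ne_zero {N : ℕ} [NeZero N] {i j k : ZMod N} (hij : i ≠ j)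
    (hjk : j ≠ k) (hik : i ≠ k) : signedArea (vtx N i) (vtx N j) (vtx N k) ≠ 0 := by
  have key : ∀ a b c : ZMod N, a.val < b.val → b.val < c.val →
      0 < signedArea (vtx N a) (vtx N b) (vtx N c) := fun a b c => signedArea_vtx_pos
  have hij' := (ZMod.val_injective N).ne hij
  have hjk' := (ZMod.val_injective N).ne hjk
  have hik' := (ZMod.val_injective N).ne hik
  have r₁ := signedArea_rotate
  have r₂ := signedArea_swap
  rcases lt_or_gt_of_ne hij' with h₁ | h₁ <;> rcases lt_or_gt_of_ne hjk' with h₂ | h₂ <;>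
    rcases lt_or_gt_of_ne hik' with h₃ | h₃ <;> first | omega | grind

lemma interior_cellHull_nonempty {N : ℕ} [NeZero N] {c : Finset (ZMod N)} (hc : 3 ≤ c.card) :
    (interior (cellHull N c)).Nonempty := by
  obtain ⟨x, y, z, hx, hy, hz, hxy, hxz, hyz⟩ := Finset.two_lt_card_iff.mp hc
  exact interior_convexHull_nonempty_of_signedArea (Set.mem_image_of_mem _ hx)
    (Set.mem_image_of_mem _ hy) (Set.mem_image_of_mem _ hz)
    (signedArea_vtx_ne_zero hxy hyz hxz)

lemma vtx_mem_cellHull {N : ℕ} {c : Finset (ZMod N)} {v : ZMod N} (hv : v ∈ c) :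
    vtx N v ∈ cellHull N c :=
  subset_convexHull ℝ _ (Set.mem_image_of_mem _ hv)

/-- Cells with disjoint interiors have no crossing chords. -/
lemma not_crossing_of_disjoint_interior_s16 {N : ℕ} [NeZero N] {c c' : Finset (ZMod N)}
    (hc : 3 ≤ c.card) (hc' : 3 ≤ c'.card)
    (hdisj : interior (cellHull N c) ∩ interior (cellHull N c') = ∅) {a b x y : ZMod N}
    (ha : a ∈ c) (hb : b ∈ c) (hx : x ∈ c') (hy : y ∈ c') :
    ¬ (a.val < x.val ∧ x.val < b.val ∧ b.val < y.val) := by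
  rintro ⟨hax, hxb, hby⟩
  have hconv : ∀ e : Finset (ZMod N), Convex ℝ (cellHull N e) := fun e => convex_convexHull ℝ _
  obtain ⟨f, s, hf, hf'⟩ := geometric_hahn_banach_open_open (hconv c).interior isOpen_interior
    (hconv c').interior isOpen_interior (Set.disjoint_iff_inter_eq_empty.mpr hdisj)
  have hle : ∀ p ∈ cellHull N c, f p ≤ s := by
    intro p hp
    have hp' := subset_closure hp
    rw [← (hconv c).closure_interior_eq_closure_of_nonempty_interior
      (interior_cellHull_nonempty hc)] at hp'
    exact closure_minimal (fun z hz => (hf z hz).le)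
      (isClosed_le f.continuous continuous_const) hp'
  have hge : ∀ p ∈ cellHull N c', s ≤ f p := by
    intro p hp
    have hp' := subset_closure hp
    rw [← (hconv c').closure_interior_eq_closure_of_nonempty_interior
      (interior_cellHull_nonempty hc')] at hp'
    exact closure_minimal (fun z hz => (hf' z hz).le)
      (isClosed_le continuous_const f.continuous) hp'
  have fa := hle _ (vtx_mem_cellHull ha)
  have fb := hle _ (vtx_mem_cellHull hb)
  have fx := hge _ (vtx_mem_cellHull hx)
  have fy := hge _ (vtx_mem_cellHull hy)
  have A₁ := signedArea_vtx_pos hxb hby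
  have A₂ := signedArea_vtx_pos (hax.trans hxb) hby
  have A₃ := signedArea_vtx_pos hax (hxb.trans hby)
  have A₄ := signedArea_vtx_pos hax hxb
  have hlin : signedArea (vtx N x) (vtx N b) (vtx N y) * (s - f (vtx N a)) +
      signedArea (vtx N a) (vtx N b) (vtx N y) * (f (vtx N x) - s) +
      signedArea (vtx N a) (vtx N x) (vtx N y) * (s - f (vtx N b)) +
      signedArea (vtx N a) (vtx N x) (vtx N b) * (f (vtx N y) - s) = 0 := by
    rw [apply_prod_eq f (vtx N a), apply_prod_eq f (vtx N b), apply_prod_eq f (vtx N x),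
      apply_prod_eq f (vtx N y)]
    unfold signedArea
    ring
  have B₁ := mul_nonneg A₁.le (sub_nonneg.mpr fa)
  have B₂ := mul_nonneg A₂.le (sub_nonneg.mpr fx)
  have B₃ := mul_nonneg A₃.le (sub_nonneg.mpr fb)
  have B₄ := mul_nonneg A₄.le (sub_nonneg.mpr fy)
  have ea : s - f (vtx N a) = 0 :=
    (mul_eq_zero.mp (by linarith)).resolve_left A₁.ne'
  have ex : f (vtx N x) - s = 0 :=
    (mul_eq_zero.mp (by linarith)).resolve_left A₂.ne'
  have eb : s - f (vtx N b) = 0 :=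
    (mul_eq_zero.mp (by linarith)).resolve_left A₃.ne'
  have h0 := eq_zero_of_constant_on_triangle f A₄.ne' (s := s) (by linarith) (by linarith)
    (by linarith)
  obtain ⟨p, hp⟩ := interior_cellHull_nonempty hc
  obtain ⟨p', hp'⟩ := interior_cellHull_nonempty hc'
  have := hf p hp
  have := hf' p' hp'
  have := h0 p
  have := h0 p'
  linarith

lemma vtx_injective {N : ℕ} (hN : 3 ≤ N) : Function.Injective (vtx N) := by
  have : NeZero N := ⟨by omega⟩
  intro v k h
  by_contra hvk
  obtain ⟨w, -, hw⟩ := Finset.exists_mem_notMem_of_card_lt_card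
    (s := ({v, k} : Finset (ZMod N))) (t := Finset.univ)
    (by rw [Finset.card_univ, ZMod.card]; exact Finset.card_le_two.trans_lt hN)
  simp only [Finset.mem_insert, Finset.mem_singleton, not_or] at hw
  apply signedArea_vtx_ne_zero hvk (Ne.symm hw.2) (Ne.symm hw.1)
  rw [h, signedArea]
  ring

lemma mem_of_vtx_mem_cellHull {N : ℕ} (hN : 3 ≤ N) {c : Finset (ZMod N)} {k : ZMod N}
    (hk : vtx N k ∈ cellHull N c) : k ∈ c := by
  by_contra hkc
  let g : ℝ × ℝ →ₗ[ℝ] ℝ :=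
    (vtx N k).1 • LinearMap.fst ℝ ℝ ℝ + (vtx N k).2 • LinearMap.snd ℝ ℝ ℝ
  have hsub : cellHull N c ⊆ {p | g p < 1} := by
    refine convexHull_min ?_ (convex_halfSpace_lt g.isLinear 1)
    rintro _ ⟨v, hv, rfl⟩
    have hvk : v ≠ k := fun h => hkc (h ▸ hv)
    have hk1 : (vtx N k).1 ^ 2 + (vtx N k).2 ^ 2 = 1 := by simp [vtx]
    have hv1 : (vtx N v).1 ^ 2 + (vtx N v).2 ^ 2 = 1 := by simp [vtx]
    have hne : (vtx N v).1 ≠ (vtx N k).1 ∨ (vtx N v).2 ≠ (vtx N k).2 := by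
      by_contra! h
      exact hvk (vtx_injective hN (Prod.ext h.1 h.2))
    change (vtx N k).1 * (vtx N v).1 + (vtx N k).2 * (vtx N v).2 < 1
    rcases hne with h | h
    · nlinarith [sq_pos_of_ne_zero (sub_ne_zero.mpr h), sq_nonneg ((vtx N v).2 - (vtx N k).2)]
    · nlinarith [sq_pos_of_ne_zero (sub_ne_zero.mpr h), sq_nonneg ((vtx N v).1 - (vtx N k).1)]
  have h := hsub hk
  have hk1 : (vtx N k).1 ^ 2 + (vtx N k).2 ^ 2 = 1 := by simp [vtx]
  change (vtx N k).1 * (vtx N k).1 + (vtx N k).2 * (vtx N k).2 < 1 at h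
  nlinarith

lemma signedArea_nonpos_of_mem_cellHull {N : ℕ} {c : Finset (ZMod N)} {p q : ℝ × ℝ}
    (h : ∀ v ∈ c, signedArea p q (vtx N v) ≤ 0) {x : ℝ × ℝ} (hx : x ∈ cellHull N c) :
    signedArea p q x ≤ 0 := by
  have hconv : Convex ℝ {x | signedArea p q x ≤ 0} := by
    intro y hy z hz a b ha hb hab
    simp only [Set.mem_ofPred_eq] at hy hz ⊢
    have : signedArea p q (a • y + b • z) = a * signedArea p q y + b * signedArea p q z := by
      obtain rfl : b = 1 - a := by linarith
      simp [signedArea]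
      ring
    rw [this]
    nlinarith
  refine convexHull_min ?_ hconv hx
  rintro _ ⟨v, hv, rfl⟩
  exact h v hv

/-- Every vertex strictly between the first and the last one lies strictly inside (in the linear
order) of some cell of a `d`-angulation. -/
lemma exists_cell_straddling {N d : ℕ} (hN : 3 ≤ N) {T : Finset (Finset (ZMod N))}
    (hT : IsDAngulation N d T) {k : ZMod N} (hk₀ : 0 < k.val) (hk₁ : k.val < N - 1) :
    ∃ c ∈ T, k ∈ c ∧ (∃ u ∈ c, u.val < k.val) ∧ ∃ v ∈ c, k.val < v.val := by
  have : NeZero N := ⟨by omega⟩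
  obtain ⟨l, hl⟩ : ∃ l : ZMod N, l.val = N - 1 :=
    ⟨((N - 1 : ℕ) : ZMod N), ZMod.val_natCast_of_lt (by omega)⟩
  have h0 : (0 : ZMod N).val = 0 := ZMod.val_zero
  set z : ℝ × ℝ := (1 / 2 : ℝ) • vtx N 0 + (1 / 2 : ℝ) • vtx N l with hz
  have hpoly : Convex ℝ (convexHull ℝ (Set.range (vtx N))) := convex_convexHull ℝ _
  have hv : ∀ v, vtx N v ∈ convexHull ℝ (Set.range (vtx N)) :=
    fun v => subset_convexHull ℝ _ (Set.mem_range_self v)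
  have hzmem : z ∈ convexHull ℝ (Set.range (vtx N)) :=
    hpoly (hv 0) (hv l) (by norm_num) (by norm_num) (by norm_num)
  have hseg : openSegment ℝ (vtx N k) z ⊆
      ⋃ c ∈ T, (openSegment ℝ (vtx N k) z ∩ cellHull N c) := by
    intro x hx
    have hx' := hpoly.openSegment_subset (hv k) hzmem hx
    rw [← hT.2.1] at hx'
    simp only [Set.mem_iUnion, exists_prop] at hx' ⊢
    obtain ⟨c, hc, hxc⟩ := hx'
    exact ⟨c, hc, hx, hxc⟩
  have hcl := closure_mono hseg
    (segment_subset_closure_openSegment (left_mem_segment ℝ (vtx N k) z))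
  rw [Finset.closure_biUnion] at hcl
  simp only [Set.mem_iUnion, exists_prop] at hcl
  obtain ⟨c, hc, hkc⟩ := hcl
  have hclosed : IsClosed (cellHull N c) :=
    ((Set.toFinite _).isCompact_convexHull (𝕜 := ℝ)).isClosed
  obtain ⟨x, hxseg, hxc⟩ := closure_nonempty_iff.mp ⟨_, hkc⟩
  have hkmem : k ∈ c := mem_of_vtx_mem_cellHull hN
    (hclosed.closure_subset_iff.mpr Set.inter_subset_right hkc)
  obtain ⟨a, b, ha, hb, hab, rfl⟩ := hxseg
  obtain rfl : a = 1 - b := by linarith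
  have hA := signedArea_vtx_pos (i := 0) (j := k) (k := l) (by omega) (by omega)
  refine ⟨c, hc, hkmem, ?_, ?_⟩
  · by_contra! hcon
    have hneg := signedArea_nonpos_of_mem_cellHull (p := vtx N k) (q := vtx N l) (fun v hv => by
      have hle := hcon v hv
      have hlt := ZMod.val_lt v
      rcases hle.eq_or_lt with h | h
      · rw [ZMod.val_injective N h, signedArea]
        exact le_of_eq (by ring)
      rcases eq_or_ne v.val l.val with h' | h'
      · rw [ZMod.val_injective N h', signedArea]
        exact le_of_eq (by ring)
      rw [signedArea_swap]
      have := signedArea_vtx_pos h (show v.val < l.val by omega)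
      linarith) hxc
    have e : signedArea (vtx N k) (vtx N l) ((1 - b) • vtx N k + b • z) =
        b / 2 * signedArea (vtx N 0) (vtx N k) (vtx N l) := by
      simp [hz, signedArea]
      ring
    rw [e] at hneg
    have := mul_pos (half_pos hb) hA
    linarith
  · by_contra! hcon
    have hneg := signedArea_nonpos_of_mem_cellHull (p := vtx N 0) (q := vtx N k) (fun v hv => by
      have hle := hcon v hv
      rcases hle.eq_or_lt with h | h
      · rw [ZMod.val_injective N h, signedArea]
        exact le_of_eq (by ring)
      rcases eq_or_ne v.val (0 : ZMod N).val with h' | h'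
      · rw [ZMod.val_injective N h', signedArea]
        exact le_of_eq (by ring)
      rw [signedArea_swap]
      have := signedArea_vtx_pos (i := 0) (show (0 : ZMod N).val < v.val by omega) h
      linarith) hxc
    have e : signedArea (vtx N 0) (vtx N k) ((1 - b) • vtx N k + b • z) =
        b / 2 * signedArea (vtx N 0) (vtx N k) (vtx N l) := by
      simp [hz, signedArea]
      ring
    rw [e] at hneg
    have := mul_pos (half_pos hb) hA
    linarith

/-- The ways to choose, for every `k ∈ S`, a cell of `𝒯` containing `k` so that no cell is chosen
more than `m` times; outside `S` the choice is `∅`. -/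
def assignments (m : ℕ) (𝒯 : Finset (Finset ℕ)) (S : Finset ℕ) : Set (ℕ → Finset ℕ) :=
  {q | (∀ k ∈ S, q k ∈ 𝒯 ∧ k ∈ q k) ∧ (∀ k ∉ S, q k = ∅) ∧
    ∀ c ∈ 𝒯, (S.filter (fun k => q k = c)).card ≤ m}

/-- The elements of `c` that are neither the smallest nor the largest one. -/
def innerVertices (c : Finset ℕ) : Finset ℕ :=
  c.filter (fun k => (∃ u ∈ c, u < k) ∧ ∃ v ∈ c, k < v)

lemma mem_innerVertices {c : Finset ℕ} {k : ℕ} :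
    k ∈ innerVertices c ↔ k ∈ c ∧ (∃ u ∈ c, u < k) ∧ ∃ v ∈ c, k < v := by
  simp [innerVertices]

lemma card_innerVertices {c : Finset ℕ} (hc : 2 ≤ c.card) :
    (innerVertices c).card = c.card - 2 := by
  have hne : c.Nonempty := Finset.card_pos.mp (by omega)
  have hlt := Finset.min'_lt_max'_of_card c hc
  have heq : innerVertices c = (c.erase (c.min' hne)).erase (c.max' hne) := by
    ext k
    simp only [mem_innerVertices, Finset.mem_erase]
    constructor
    · rintro ⟨hk, ⟨u, hu, huk⟩, v, hv, hkv⟩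
      have := c.min'_le u hu
      have := c.le_max' v hv
      exact ⟨by omega, by omega, hk⟩
    · rintro ⟨h₁, h₂, hk⟩
      have := c.min'_le k hk
      have := c.le_max' k hk
      exact ⟨hk, ⟨_, c.min'_mem hne, by omega⟩, _, c.max'_mem hne, by omega⟩
  rw [heq, Finset.card_erase_of_mem, Finset.card_erase_of_mem (c.min'_mem hne)]
  · omega
  · exact Finset.mem_erase.mpr ⟨hlt.ne', c.max'_mem hne⟩

/-- No chord of a cell crosses a chord of another cell. -/
def Noncrossing (𝒯 : Finset (Finset ℕ)) : Prop :=
  ∀ c ∈ 𝒯, ∀ c' ∈ 𝒯, c ≠ c' → ∀ a ∈ c, ∀ b ∈ c, ∀ x ∈ c', ∀ y ∈ c',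
    ¬ (a < x ∧ x < b ∧ b < y)

lemma Noncrossing.mem_Icc {𝒯 : Finset (Finset ℕ)} (hNC : Noncrossing 𝒯) {c c' : Finset ℕ}
    (hc : c ∈ 𝒯) (hc' : c' ∈ 𝒯) (hne : c ≠ c') {u v k y : ℕ} (hu : u ∈ c) (hv : v ∈ c)
    (hk : k ∈ c') (huk : u < k) (hkv : k < v) (hy : y ∈ c') : y ∈ Finset.Icc u v := by
  rw [Finset.mem_Icc]
  by_contra h
  rcases lt_or_ge y u with h' | h'
  · exact hNC c' hc' c hc hne.symm y hy k hk u hu v hv ⟨h', huk, hkv⟩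
  · exact hNC c hc c' hc' hne u hu v hv k hk y hy ⟨huk, hkv, by omega⟩

lemma Noncrossing.eq_of_mem_innerVertices {𝒯 : Finset (Finset ℕ)} (hNC : Noncrossing 𝒯) {d : ℕ}
    (hcard : ∀ c ∈ 𝒯, c.card = d) {c c' : Finset ℕ} (hc : c ∈ 𝒯) (hc' : c' ∈ 𝒯) {k : ℕ}
    (hk : k ∈ innerVertices c) (hk' : k ∈ innerVertices c') : c = c' := by
  by_contra hne
  obtain ⟨hkc, ⟨u₀, hu₀, hu₀k⟩, v₀, hv₀, hkv₀⟩ := mem_innerVertices.mp hk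
  obtain ⟨hkc', ⟨u₁, hu₁, hu₁k⟩, v₁, hv₁, hkv₁⟩ := mem_innerVertices.mp hk'
  have hn : c.Nonempty := ⟨k, hkc⟩
  have hn' : c'.Nonempty := ⟨k, hkc'⟩
  have hu := c.min'_mem hn
  have hv := c.max'_mem hn
  have hu' := c'.min'_mem hn'
  have hv' := c'.max'_mem hn'
  have huk := (c.min'_le u₀ hu₀).trans_lt hu₀k
  have hkv := hkv₀.trans_le (c.le_max' v₀ hv₀)
  have huk' := (c'.min'_le u₁ hu₁).trans_lt hu₁k
  have hkv' := hkv₁.trans_le (c'.le_max' v₁ hv₁)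
  have h₁ := Finset.mem_Icc.mp (hNC.mem_Icc hc hc' hne hu hv hkc' huk hkv hu')
  have h₂ := Finset.mem_Icc.mp (hNC.mem_Icc hc hc' hne hu hv hkc' huk hkv hv')
  have h₃ := Finset.mem_Icc.mp (hNC.mem_Icc hc' hc (Ne.symm hne) hu' hv' hkc huk' hkv' hu)
  have h₄ := Finset.mem_Icc.mp (hNC.mem_Icc hc' hc (Ne.symm hne) hu' hv' hkc huk' hkv' hv)
  obtain ⟨x, hx, hx'⟩ : ∃ x ∈ c, x ∉ c' := by
    by_contra! h
    exact hne (Finset.eq_of_subset_of_card_le h (by rw [hcard c hc, hcard c' hc']))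
  have hxu : x ≠ c'.min' hn' := fun h => hx' (h ▸ hu')
  have hxv : x ≠ c'.max' hn' := fun h => hx' (h ▸ hv')
  have hxk : x ≠ k := fun h => hx' (h ▸ hkc')
  have := c.min'_le x hx
  have := c.le_max' x hx
  rcases lt_or_gt_of_ne hxk with h | h
  · exact hNC c' hc' c hc (Ne.symm hne) _ hu' k hkc' x hx _ hv ⟨by omega, h, hkv⟩
  · exact hNC c hc c' hc' hne _ hu x hx k hkc' _ hv' ⟨huk, h, by omega⟩

lemma Noncrossing.card_mul_eq {𝒯 : Finset (Finset ℕ)} (hNC : Noncrossing 𝒯) {d : ℕ} (hd : 2 ≤ d)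
    (hcard : ∀ c ∈ 𝒯, c.card = d) {S : Finset ℕ} (hin : ∀ c ∈ 𝒯, innerVertices c ⊆ S)
    (hex : ∀ k ∈ S, ∃ c ∈ 𝒯, k ∈ innerVertices c) : S.card = 𝒯.card * (d - 2) := by
  have hS : S = 𝒯.biUnion innerVertices := by
    ext k
    rw [Finset.mem_biUnion]
    exact ⟨hex k, fun ⟨c, hc, hk⟩ => hin c hc hk⟩
  rw [hS, Finset.card_biUnion]
  · rw [Finset.sum_const_nat]
    intro c hc
    rw [card_innerVertices (by rw [hcard c hc]; exact hd), hcard c hc]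
  · intro c hc c' hc' hne
    exact Finset.disjoint_left.mpr fun k hk hk' => hne (hNC.eq_of_mem_innerVertices hcard hc hc' hk hk')

lemma innerVertices_subset_Ioo {c : Finset ℕ} {u v : ℕ} (h : c ⊆ Finset.Icc u v) :
    innerVertices c ⊆ Finset.Ioo u v := by
  intro k hk
  obtain ⟨-, ⟨a, ha, hak⟩, b, hb, hkb⟩ := mem_innerVertices.mp hk
  have := Finset.mem_Icc.mp (h ha)
  have := Finset.mem_Icc.mp (h hb)
  exact Finset.mem_Ioo.mpr ⟨by omega, by omega⟩

/-- In a noncrossing family in which every vertex is an inner vertex of some cell, an assignment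
must send every vertex to the cell it is an inner vertex of. -/
lemma Noncrossing.mem_innerVertices_of_assignment {𝒯 : Finset (Finset ℕ)} (hNC : Noncrossing 𝒯)
    {d M : ℕ} (hd : 3 ≤ d) (hcard : ∀ c ∈ 𝒯, c.card = d) (hsub : ∀ c ∈ 𝒯, c ⊆ Finset.Icc 0 M)
    (hex : ∀ k ∈ Finset.Ioo 0 M, ∃ c ∈ 𝒯, k ∈ innerVertices c) {q : ℕ → Finset ℕ}
    (hq : q ∈ assignments (d - 2) 𝒯 (Finset.Ioo 0 M)) {k : ℕ} (hk : k ∈ Finset.Ioo 0 M) :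
    k ∈ innerVertices (q k) := by
  obtain ⟨hq₁, -, hq₃⟩ := hq
  obtain ⟨hc, hkc⟩ := hq₁ k hk
  generalize hqk : q k = c at hc hkc
  have hn : c.Nonempty := ⟨k, hkc⟩
  set u := c.min' hn with hu_def
  set v := c.max' hn with hv_def
  have hu : u ∈ c := c.min'_mem hn
  have hv : v ∈ c := c.max'_mem hn
  have hvM := Finset.mem_Icc.mp (hsub c hc hv)
  have hcIcc : c ⊆ Finset.Icc u v :=
    fun y hy => Finset.mem_Icc.mpr ⟨c.min'_le y hy, c.le_max' y hy⟩
  set 𝒰 := 𝒯.filter (fun e => e ⊆ Finset.Icc u v) with h𝒰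
  have hIoo : Finset.Ioo u v ⊆ Finset.Ioo 0 M := Finset.Ioo_subset_Ioo (by omega) hvM.2
  have hmem : ∀ x ∈ Finset.Ioo u v, ∀ e ∈ 𝒯, x ∈ e → e ∈ 𝒰 := by
    intro x hx e he hxe
    rw [Finset.mem_Ioo] at hx
    refine Finset.mem_filter.mpr ⟨he, ?_⟩
    by_cases hce : c = e
    · exact hce ▸ hcIcc
    · exact fun y hy => hNC.mem_Icc hc he hce hu hv hxe hx.1 hx.2 hy
  have hNC' : Noncrossing 𝒰 := fun e he e' he' =>
    hNC e (Finset.mem_filter.mp he).1 e' (Finset.mem_filter.mp he').1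
  have hcount : (Finset.Ioo u v).card = 𝒰.card * (d - 2) := by
    refine hNC'.card_mul_eq (by omega) (fun e he => hcard e (Finset.mem_filter.mp he).1)
      (fun e he => innerVertices_subset_Ioo (Finset.mem_filter.mp he).2) fun x hx => ?_
    obtain ⟨e, he, hxe⟩ := hex x (hIoo hx)
    exact ⟨e, hmem x hx e he (mem_innerVertices.mp hxe).1, hxe⟩
  have hfib : (Finset.Ioo u v).card =
      ∑ e ∈ 𝒰, ((Finset.Ioo u v).filter (fun x => q x = e)).card :=
    Finset.card_eq_sum_card_fiberwise
      (fun x hx => hmem x hx _ (hq₁ x (hIoo hx)).1 (hq₁ x (hIoo hx)).2)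
  have hle : ∀ e ∈ 𝒰, ((Finset.Ioo u v).filter (fun x => q x = e)).card ≤ d - 2 := fun e he =>
    (Finset.card_le_card (Finset.filter_subset_filter _ hIoo)).trans
      (hq₃ e (Finset.mem_filter.mp he).1)
  have heq := (Finset.sum_eq_sum_iff_of_le hle).mp
    (by rw [← hfib, hcount, Finset.sum_const, smul_eq_mul])
    c (Finset.mem_filter.mpr ⟨hc, hcIcc⟩)
  have hset := Finset.eq_of_subset_of_card_le
    (Finset.filter_subset_filter (fun x => q x = c) hIoo) (by rw [heq]; exact hq₃ c hc)
  have hk' : k ∈ (Finset.Ioo u v).filter (fun x => q x = c) :=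
    hset ▸ Finset.mem_filter.mpr ⟨hk, hqk⟩
  have hk'' := Finset.mem_Ioo.mp (Finset.mem_filter.mp hk').1
  exact mem_innerVertices.mpr ⟨hkc, ⟨u, hu, hk''.1⟩, v, hv, hk''.2⟩

lemma Noncrossing.ncard_assignments_Ioo {𝒯 : Finset (Finset ℕ)} (hNC : Noncrossing 𝒯)
    {d M : ℕ} (hd : 3 ≤ d) (hcard : ∀ c ∈ 𝒯, c.card = d) (hsub : ∀ c ∈ 𝒯, c ⊆ Finset.Icc 0 M)
    (hex : ∀ k ∈ Finset.Ioo 0 M, ∃ c ∈ 𝒯, k ∈ innerVertices c) :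
    (assignments (d - 2) 𝒯 (Finset.Ioo 0 M)).ncard = 1 := by
  choose! g hg𝒯 hg using hex
  rw [Set.ncard_eq_one]
  refine ⟨fun k => if k ∈ Finset.Ioo 0 M then g k else ∅, ?_⟩
  ext q
  rw [Set.mem_singleton_iff]
  constructor
  · intro hq
    funext k
    split_ifs with hk
    · exact hNC.eq_of_mem_innerVertices hcard (hq.1 k hk).1 (hg𝒯 k hk)
        (hNC.mem_innerVertices_of_assignment hd hcard hsub (fun x hx => ⟨g x, hg𝒯 x hx, hg x hx⟩)
          hq hk) (hg k hk)
    · exact hq.2.1 k hk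
  · rintro rfl
    refine ⟨fun k hk => ?_, fun k hk => if_neg hk, fun c hc => ?_⟩
    · simp only [if_pos hk]
      exact ⟨hg𝒯 k hk, (mem_innerVertices.mp (hg k hk)).1⟩
    · rw [← hcard c hc, ← card_innerVertices (by rw [hcard c hc]; omega)]
      refine Finset.card_le_card fun k hk => ?_
      obtain ⟨hk, hgk⟩ := Finset.mem_filter.mp hk
      simp only [if_pos hk] at hgk
      exact hgk ▸ hg k hk

lemma assignments_eq_empty_of_card_lt {m : ℕ} {𝒯 : Finset (Finset ℕ)} {S : Finset ℕ}
    (h : 𝒯.card * m < S.card) : assignments m 𝒯 S = ∅ := by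
  rw [Set.eq_empty_iff_forall_notMem]
  rintro q ⟨hq₁, -, hq₃⟩
  have hfib := Finset.card_eq_sum_card_fiberwise (f := q) (s := S) (t := 𝒯)
    (fun k hk => (hq₁ k hk).1)
  have := Finset.sum_le_card_nsmul 𝒯 _ m hq₃
  rw [smul_eq_mul] at this
  omega

lemma ncard_assignments_empty (m : ℕ) (𝒯 : Finset (Finset ℕ)) :
    (assignments m 𝒯 ∅).ncard = 1 := by
  rw [Set.ncard_eq_one]
  refine ⟨fun _ => ∅, ?_⟩
  ext q
  simp [assignments, funext_iff]

lemma finite_assignments (m : ℕ) (𝒯 : Finset (Finset ℕ)) (S : Finset ℕ) :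
    (assignments m 𝒯 S).Finite := by
  have : Function.Injective
      (fun (q : assignments m 𝒯 S) (k : S) => (⟨q.1 k, (q.2.1 k k.2).1⟩ : 𝒯)) := by
    rintro ⟨q, hq⟩ ⟨q', hq'⟩ h
    refine Subtype.ext (funext fun k => ?_)
    by_cases hk : k ∈ S
    · exact congrArg Subtype.val (congrFun h ⟨k, hk⟩)
    · exact (hq.2.1 k hk).trans (hq'.2.1 k hk).symm
  exact Set.finite_coe_iff.mp (Finite.of_injective _ this)

/-- Splitting assignments by the set `B` of vertices that are sent to a fixed cell `α`. -/
lemma ncard_assignments_eq_sum_powerset (m : ℕ) {𝒯 : Finset (Finset ℕ)} {α : Finset ℕ}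
    (hα : α ∈ 𝒯) (hα₀ : α.Nonempty) (S : Finset ℕ) :
    (assignments m 𝒯 S).ncard = ∑ B ∈ (S ∩ α).powerset,
      if B.card ≤ m then (assignments m (𝒯.erase α) (S \ B)).ncard else 0 := by
  classical
  have hfin := finite_assignments m 𝒯 S
  rw [Set.ncard_eq_toFinset_card _ hfin, Finset.card_eq_sum_card_fiberwise
    (f := fun q => S.filter (fun k => q k = α)) (t := (S ∩ α).powerset)]
  · refine Finset.sum_congr rfl fun B hB => ?_
    rw [Finset.mem_powerset] at hB
    split_ifs with hBm
    · rw [← Set.ncard_coe_finset]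
      refine Set.ncard_congr (fun q _ k => if k ∈ B then ∅ else q k) ?_ ?_ ?_
      · intro q hq
        simp only [Finset.coe_filter, Set.Finite.mem_toFinset, Set.mem_ofPred_eq] at hq
        obtain ⟨⟨h₁, h₂, h₃⟩, hqB⟩ := hq
        have hB' : ∀ k, k ∈ B ↔ k ∈ S ∧ q k = α := fun k => by rw [← hqB, Finset.mem_filter]
        refine ⟨fun k hk => ?_, fun k hk => ?_, fun c hc => ?_⟩
        · rw [Finset.mem_sdiff] at hk
          simp only [if_neg hk.2]
          exact ⟨Finset.mem_erase.mpr ⟨fun h => hk.2 ((hB' k).mpr ⟨hk.1, h⟩), (h₁ k hk.1).1⟩,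
            (h₁ k hk.1).2⟩
        · simp only
          split_ifs with hkB
          · rfl
          · exact h₂ k fun hkS => hk (Finset.mem_sdiff.mpr ⟨hkS, hkB⟩)
        · refine (Finset.card_le_card fun k hk => ?_).trans (h₃ c (Finset.mem_of_mem_erase hc))
          simp only [Finset.mem_filter, Finset.mem_sdiff] at hk ⊢
          rw [if_neg hk.1.2] at hk
          exact ⟨hk.1.1, hk.2⟩
      · intro q q' hq hq' heq
        simp only [Finset.coe_filter, Set.Finite.mem_toFinset, Set.mem_ofPred_eq] at hq hq'
        funext k
        by_cases hk : k ∈ B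
        · have h := hk
          rw [← hq.2, Finset.mem_filter] at h
          rw [← hq'.2, Finset.mem_filter] at hk
          rw [h.2, hk.2]
        · simpa [hk] using congrFun heq k
      · rintro q ⟨h₁, h₂, h₃⟩
        have hqα : ∀ k, q k ≠ α := by
          intro k hk
          by_cases hkS : k ∈ S \ B
          · exact Finset.ne_of_mem_erase (h₁ k hkS).1 hk
          · rw [h₂ k hkS] at hk
            exact hα₀.ne_empty hk.symm
        have hfilter : S.filter (fun k => (if k ∈ B then α else q k) = α) = B := by
          ext k
          rw [Finset.mem_filter]
          constructor
          · rintro ⟨-, h⟩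
            by_contra hk
            rw [if_neg hk] at h
            exact hqα k h
          · exact fun hk => ⟨(Finset.mem_inter.mp (hB hk)).1, if_pos hk⟩
        refine ⟨fun k => if k ∈ B then α else q k, ?_, ?_⟩
        · simp only [Finset.coe_filter, Set.Finite.mem_toFinset, Set.mem_ofPred_eq]
          refine ⟨⟨fun k hk => ?_, fun k hk => ?_, fun c hc => ?_⟩, hfilter⟩
          · simp only
            split_ifs with hkB
            · exact ⟨hα, (Finset.mem_inter.mp (hB hkB)).2⟩
            · have := h₁ k (Finset.mem_sdiff.mpr ⟨hk, hkB⟩)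
              exact ⟨Finset.mem_of_mem_erase this.1, this.2⟩
          · simp only
            rw [if_neg fun hkB => hk (Finset.mem_inter.mp (hB hkB)).1]
            exact h₂ k fun h => hk (Finset.mem_sdiff.mp h).1
          · by_cases hcα : c = α
            · rw [hcα, hfilter]
              exact hBm
            · refine (Finset.card_le_card fun k hk => ?_).trans
                (h₃ c (Finset.mem_erase.mpr ⟨hcα, hc⟩))
              simp only [Finset.mem_filter, Finset.mem_sdiff] at hk ⊢
              have hkB : k ∉ B := by
                intro hkB
                rw [if_pos hkB] at hk
                exact hcα hk.2.symm
              rw [if_neg hkB] at hk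
              exact ⟨⟨hk.1, hkB⟩, hk.2⟩
        · funext k
          simp only
          split_ifs with hkB
          · exact (h₂ k fun h => (Finset.mem_sdiff.mp h).2 hkB).symm
          · rfl
    · rw [Finset.card_eq_zero, Finset.filter_eq_empty_iff]
      intro q hq hqB
      rw [Set.Finite.mem_toFinset] at hq
      exact hBm (hqB ▸ hq.2.2 α hα)
  · intro q hq
    rw [Finset.mem_coe, Set.Finite.mem_toFinset] at hq
    rw [Finset.mem_coe, Finset.mem_powerset]
    intro k hk
    obtain ⟨hkS, hk⟩ := Finset.mem_filter.mp hk
    exact Finset.mem_inter.mpr ⟨hkS, hk ▸ (hq.1 k hkS).2⟩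

lemma assignments_eq_empty_of_notMem {m : ℕ} {𝒯 : Finset (Finset ℕ)} {S : Finset ℕ} {k : ℕ}
    (hk : k ∈ S) (h : ∀ c ∈ 𝒯, k ∉ c) : assignments m 𝒯 S = ∅ :=
  Set.eq_empty_iff_forall_notMem.mpr fun _ hq => h _ (hq.1 k hk).1 (hq.1 k hk).2

/-- Splitting assignments by the set `B` of shared vertices that are sent to a fixed cell `α`,
when the vertices in `P` belong to `α` only. -/
lemma ncard_assignments_eq_sum_shared (m : ℕ) {𝒯 : Finset (Finset ℕ)} {α P : Finset ℕ}
    (hα : α ∈ 𝒯) (hα₀ : α.Nonempty) (hPα : P ⊆ α) (hP : ∀ c ∈ 𝒯.erase α, Disjoint P c)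
    (S : Finset ℕ) :
    (assignments m 𝒯 S).ncard = ∑ B ∈ (S ∩ (α \ P)).powerset,
      if B.card + (S ∩ P).card ≤ m
        then (assignments m (𝒯.erase α) ((S \ P) \ B)).ncard else 0 := by
  rw [ncard_assignments_eq_sum_powerset m hα hα₀ S]
  have hdisj : ∀ B ∈ (S ∩ (α \ P)).powerset, Disjoint B (S ∩ P) := by
    intro B hB
    rw [Finset.disjoint_left]
    intro k hk hk'
    have := Finset.mem_powerset.mp hB hk
    simp only [Finset.mem_inter, Finset.mem_sdiff] at this hk'
    exact this.2.2 hk'.2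
  symm
  refine Finset.sum_of_injOn (fun B => B ∪ (S ∩ P)) ?_ ?_ ?_ ?_
  · intro B hB B' hB' h
    have h₁ := (Finset.union_sdiff_cancel_right (hdisj B hB)).symm
    have h₂ := Finset.union_sdiff_cancel_right (hdisj B' hB')
    simp only at h
    rw [h₁, h, h₂]
  · intro B hB
    simp only [Finset.mem_coe, Finset.mem_powerset] at hB ⊢
    exact Finset.union_subset (hB.trans (Finset.inter_subset_inter_left Finset.sdiff_subset))
      (Finset.inter_subset_inter_left hPα)
  · intro B hB hB'
    rw [Finset.mem_powerset] at hB
    by_cases hSP : S ∩ P ⊆ B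
    · refine absurd ⟨B \ P, ?_, ?_⟩ hB'
      · rw [Finset.mem_coe, Finset.mem_powerset]
        intro k hk
        have := hB (Finset.mem_sdiff.mp hk).1
        simp only [Finset.mem_inter, Finset.mem_sdiff] at this hk ⊢
        exact ⟨this.1, this.2, hk.2⟩
      · ext k
        have h₁ := @hB k
        have h₂ := @hSP k
        simp only [Finset.mem_inter, Finset.mem_sdiff, Finset.mem_union] at h₁ h₂ ⊢
        tauto
    · obtain ⟨k, hk, hkB⟩ := Finset.not_subset.mp hSP
      rw [Finset.mem_inter] at hk
      rw [assignments_eq_empty_of_notMem (Finset.mem_sdiff.mpr ⟨hk.1, hkB⟩)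
        fun c hc => Finset.disjoint_left.mp (hP c hc) hk.2]
      simp
  · intro B hB
    rw [Finset.card_union_of_disjoint (hdisj B hB)]
    congr 3
    ext k
    simp only [Finset.mem_inter, Finset.mem_sdiff, Finset.mem_union]
    tauto

/-- The cells of `T`, with vertices labelled by natural numbers. -/
def cellLabels {N : ℕ} (T : Finset (Finset (ZMod N))) : Finset (Finset ℕ) :=
  T.image (fun c => c.image ZMod.val)

/-- The labels of the vertices strictly between `i` and `j`, going counterclockwise. -/
def arc (N : ℕ) (i j : ZMod N) : Finset ℕ :=
  Finset.univ.image (fun k : Fin (pathLen N i j) => (i + 1 + ((k : ℕ) : ZMod N)).val)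

lemma image_val_injective (N : ℕ) [NeZero N] :
    Function.Injective (fun c : Finset (ZMod N) => c.image ZMod.val) :=
  Finset.image_injective (ZMod.val_injective N)

lemma val_mem_image_val {N : ℕ} [NeZero N] {c : Finset (ZMod N)} {v : ZMod N} :
    v.val ∈ c.image ZMod.val ↔ v ∈ c :=
  (ZMod.val_injective N).mem_finset_image

lemma arc_label_injective {N : ℕ} [NeZero N] (i j : ZMod N) :
    Function.Injective
      (fun k : Fin (pathLen N i j) => (i + 1 + ((k : ℕ) : ZMod N)).val) := by
  intro k l h
  have hlt : pathLen N i j < N := ZMod.val_lt _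
  have h' := congrArg ZMod.val (add_left_cancel (ZMod.val_injective N h))
  rw [ZMod.val_natCast_of_lt (k.2.trans hlt), ZMod.val_natCast_of_lt (l.2.trans hlt)] at h'
  exact Fin.ext h'

lemma dPathCount_eq_ncard {N : ℕ} [NeZero N] (d : ℕ) (T : Finset (Finset (ZMod N)))
    (i j : ZMod N) :
    dPathCount N d T i j = (assignments (d - 2) (cellLabels T) (arc N i j)).ncard := by
  classical
  set pos := fun k : Fin (pathLen N i j) => (i + 1 + ((k : ℕ) : ZMod N)).val with hpos
  have hinj : Function.Injective pos := arc_label_injective i j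
  have hval := image_val_injective N
  have hmem : ∀ x, x ∈ arc N i j ↔ ∃ k, pos k = x := fun x => by simp [arc, hpos]
  set F : (Fin (pathLen N i j) → {c // c ∈ T}) → ℕ → Finset ℕ := fun q =>
    Function.extend pos (fun k => (q k : Finset (ZMod N)).image ZMod.val) (fun _ => ∅) with hF
  have hFpos : ∀ q k, F q (pos k) = (q k : Finset (ZMod N)).image ZMod.val :=
    fun q k => hinj.extend_apply _ _ _
  have hcount : ∀ q c, ((arc N i j).filter (fun x => F q x = c.image ZMod.val)).card =
      (Finset.univ.filter (fun k => (q k : Finset (ZMod N)) = c)).card := by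
    intro q c
    rw [← Finset.card_image_of_injective _ hinj]
    congr 1
    ext x
    simp only [Finset.mem_filter, hmem, Finset.mem_image, Finset.mem_univ, true_and]
    constructor
    · rintro ⟨⟨k, rfl⟩, h⟩
      rw [hFpos] at h
      exact ⟨k, hval h, rfl⟩
    · rintro ⟨k, rfl, rfl⟩
      exact ⟨⟨k, rfl⟩, hFpos q k⟩
  have hiff : ∀ q, F q ∈ assignments (d - 2) (cellLabels T) (arc N i j) ↔
      IsDPath N d T i j q := by
    intro q
    constructor
    · rintro ⟨h₁, -, h₃⟩
      refine ⟨fun k => ?_, fun c hc => ?_⟩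
      · have := (h₁ (pos k) ((hmem _).mpr ⟨k, rfl⟩)).2
        rw [hFpos] at this
        exact val_mem_image_val.mp this
      · rw [← hcount]
        exact h₃ _ (Finset.mem_image_of_mem _ hc)
    · rintro ⟨h₁, h₂⟩
      refine ⟨fun x hx => ?_, fun x hx => ?_, fun c hc => ?_⟩
      · obtain ⟨k, rfl⟩ := (hmem x).mp hx
        rw [hFpos]
        exact ⟨Finset.mem_image_of_mem _ (q k).2, val_mem_image_val.mpr (h₁ k)⟩
      · exact Function.extend_apply' _ _ _ fun h => hx ((hmem x).mpr h)
      · obtain ⟨e, he, rfl⟩ := Finset.mem_image.mp hc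
        rw [hcount]
        exact h₂ e he
  change Set.ncard {q | IsDPath N d T i j q} = _
  refine Set.ncard_congr (fun q _ => F q) (fun q hq => (hiff q).mpr hq) ?_ ?_
  · intro q q' _ _ h
    funext k
    have := congrFun h (pos k)
    rw [hFpos, hFpos] at this
    exact Subtype.ext (hval this)
  · intro p hp
    have hex : ∀ k, ∃ c : {c // c ∈ T}, c.1.image ZMod.val = p (pos k) := by
      intro k
      obtain ⟨c, hc, h⟩ := Finset.mem_image.mp (hp.1 (pos k) ((hmem _).mpr ⟨k, rfl⟩)).1
      exact ⟨⟨c, hc⟩, h⟩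
    choose q hq using hex
    have hFq : F q = p := by
      funext x
      by_cases hx : x ∈ arc N i j
      · obtain ⟨k, rfl⟩ := (hmem x).mp hx
        rw [hFpos, hq]
      · rw [hp.2.1 x hx]
        exact Function.extend_apply' _ _ _ fun h => hx ((hmem x).mpr h)
    exact ⟨q, (hiff q).mp (hFq.symm ▸ hp), hFq⟩

lemma arc_of_lt {N i j : ℕ} (hij : i < j) (hj : j < N) :
    arc N (i : ZMod N) (j : ZMod N) = Finset.Ioo i j := by
  have hlen : pathLen N (i : ZMod N) (j : ZMod N) = j - i - 1 := by
    obtain ⟨t, rfl⟩ := Nat.exists_eq_add_of_lt hij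
    rw [pathLen, show (((i + t + 1 : ℕ) : ZMod N) - i - 1) = ((t : ℕ) : ZMod N) by
      push_cast; ring, ZMod.val_natCast_of_lt (by omega)]
    omega
  have hval : ∀ k : ℕ, i + 1 + k < N → ((i : ZMod N) + 1 + (k : ZMod N)).val = i + 1 + k := by
    intro k hk
    rw [← ZMod.val_natCast_of_lt hk]
    push_cast
    rfl
  ext x
  simp only [arc, Finset.mem_image, Finset.mem_univ, true_and, Finset.mem_Ioo]
  constructor
  · rintro ⟨⟨k, hk⟩, rfl⟩
    rw [hlen] at hk
    rw [hval k (by omega)]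
    omega
  · rintro ⟨h₁, h₂⟩
    exact ⟨⟨x - i - 1, by omega⟩, (hval (x - i - 1) (by omega)).trans (by omega)⟩

lemma arc_of_le {N i j : ℕ} (hji : j ≤ i) (hi : i < N) :
    arc N (i : ZMod N) (j : ZMod N) = Finset.Ioo i N ∪ Finset.range j := by
  have hlen : pathLen N (i : ZMod N) (j : ZMod N) = N + j - i - 1 := by
    obtain ⟨t, ht⟩ := Nat.exists_eq_add_of_lt (show i < N + j by omega)
    have ht' : ((N : ZMod N) + j) = i + t + 1 := by exact_mod_cast congrArg (Nat.cast) ht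
    rw [ZMod.natCast_self, zero_add] at ht'
    rw [pathLen, ht', show ((i : ZMod N) + t + 1 - i - 1) = ((t : ℕ) : ZMod N) by ring,
      ZMod.val_natCast_of_lt (by omega)]
    omega
  have hval : ∀ k : ℕ, ((i : ZMod N) + 1 + (k : ZMod N)).val = (i + 1 + k) % N := by
    intro k
    rw [← ZMod.val_natCast]
    push_cast
    rfl
  ext x
  simp only [arc, Finset.mem_image, Finset.mem_univ, true_and, Finset.mem_Ioo, Finset.mem_union,
    Finset.mem_range]
  constructor
  · rintro ⟨⟨k, hk⟩, rfl⟩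
    rw [hlen] at hk
    rw [hval k]
    rcases lt_or_ge (i + 1 + k) N with h | h
    · rw [Nat.mod_eq_of_lt h]
      omega
    · rw [Nat.mod_eq_sub_mod h, Nat.mod_eq_of_lt (by omega)]
      omega
  · rintro (⟨h₁, h₂⟩ | h)
    · refine ⟨⟨x - i - 1, by omega⟩, (hval (x - i - 1)).trans ?_⟩
      rw [Nat.mod_eq_of_lt (by omega)]
      omega
    · refine ⟨⟨x + N - i - 1, by omega⟩, (hval (x + N - i - 1)).trans ?_⟩
      rw [Nat.mod_eq_sub_mod (by omega), Nat.mod_eq_of_lt (by omega)]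
      omega

lemma IsDAngulation.noncrossing_cellLabels {N d : ℕ} [NeZero N] (hd : 3 ≤ d)
    {T : Finset (Finset (ZMod N))} (hT : IsDAngulation N d T) : Noncrossing (cellLabels T) := by
  intro c hc c' hc' hne a ha b hb x hx y hy
  obtain ⟨e, he, rfl⟩ := Finset.mem_image.mp hc
  obtain ⟨e', he', rfl⟩ := Finset.mem_image.mp hc'
  obtain ⟨a, ha', rfl⟩ := Finset.mem_image.mp ha
  obtain ⟨b, hb', rfl⟩ := Finset.mem_image.mp hb
  obtain ⟨x, hx', rfl⟩ := Finset.mem_image.mp hx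
  obtain ⟨y, hy', rfl⟩ := Finset.mem_image.mp hy
  have hee : e ≠ e' := fun h => hne (by rw [h])
  exact not_crossing_of_disjoint_interior_s16 (by rw [hT.1 e he]; exact hd)
    (by rw [hT.1 e' he']; exact hd) (hT.2.2 e he e' he' hee) ha' hb' hx' hy'

lemma IsDAngulation.card_of_mem_cellLabels {N d : ℕ} [NeZero N] {T : Finset (Finset (ZMod N))}
    (hT : IsDAngulation N d T) {c : Finset ℕ} (hc : c ∈ cellLabels T) : c.card = d := by
  obtain ⟨e, he, rfl⟩ := Finset.mem_image.mp hc
  rw [Finset.card_image_of_injective _ (ZMod.val_injective N), hT.1 e he]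

lemma lt_of_mem_cellLabels {N : ℕ} [NeZero N] {T : Finset (Finset (ZMod N))} {c : Finset ℕ}
    (hc : c ∈ cellLabels T) {x : ℕ} (hx : x ∈ c) : x < N := by
  obtain ⟨e, he, rfl⟩ := Finset.mem_image.mp hc
  obtain ⟨v, -, rfl⟩ := Finset.mem_image.mp hx
  exact ZMod.val_lt v

lemma IsDAngulation.exists_mem_innerVertices {N d : ℕ} (hN : 3 ≤ N)
    {T : Finset (Finset (ZMod N))} (hT : IsDAngulation N d T) {k : ℕ} (hk₀ : 0 < k)
    (hk₁ : k < N - 1) : ∃ c ∈ cellLabels T, k ∈ innerVertices c := by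
  have : NeZero N := ⟨by omega⟩
  have hval : ((k : ℕ) : ZMod N).val = k := ZMod.val_natCast_of_lt (by omega)
  obtain ⟨c, hc, hkc, ⟨u, hu, huk⟩, v, hv, hkv⟩ :=
    exists_cell_straddling hN hT (k := (k : ZMod N)) (by omega) (by omega)
  have himg : ∀ w ∈ c, w.val ∈ c.image ZMod.val := fun w hw => Finset.mem_image_of_mem _ hw
  exact ⟨c.image ZMod.val, Finset.mem_image_of_mem _ hc, mem_innerVertices.mpr
    ⟨hval ▸ himg _ hkc, ⟨_, himg u hu, by omega⟩, _, himg v hv, by omega⟩⟩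

/-- A cell other than the one cut off by the chord from `0` to `n - 1` lies on the other side of
this chord. -/
lemma Noncrossing.subset_Icc_of_ne {𝒯 : Finset (Finset ℕ)} (hNC : Noncrossing 𝒯) {n N : ℕ}
    (hcard : ∀ c ∈ 𝒯, c.card = (insert 0 (Finset.Ico (n - 1) N)).card)
    (hα : insert 0 (Finset.Ico (n - 1) N) ∈ 𝒯) (hn : n ≤ N) (hn₀ : 0 < n)
    (hlt : ∀ c ∈ 𝒯, ∀ x ∈ c, x < N) {c : Finset ℕ} (hc : c ∈ 𝒯)
    (hne : c ≠ insert 0 (Finset.Ico (n - 1) N)) : c ⊆ Finset.Icc 0 (n - 1) := by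
  obtain ⟨y, hy, hyα⟩ : ∃ y ∈ c, y ∉ insert 0 (Finset.Ico (n - 1) N) := by
    by_contra! h
    exact hne (Finset.eq_of_subset_of_card_le h (hcard c hc).ge)
  intro x hx
  have hyN := hlt c hc y hy
  rw [Finset.mem_Icc]
  by_contra h
  rw [Finset.mem_insert, Finset.mem_Ico] at hyα
  exact hNC _ hα c hc hne.symm 0 (Finset.mem_insert_self _ _) (n - 1)
    (Finset.mem_insert_of_mem (Finset.mem_Ico.mpr ⟨le_rfl, by omega⟩)) y hy x hx
    ⟨by omega, by omega, by omega⟩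

lemma image_val_cutoff_cell {d n N : ℕ} (hd : 3 ≤ d) (hn : 3 ≤ n) (hN : N = n + d - 2) :
    (insert (0 : ZMod N)
      (Finset.image (fun t : Fin (d - 1) => (((n - 1) + (t : ℕ) : ℕ) : ZMod N))
        Finset.univ)).image ZMod.val = insert 0 (Finset.Ico (n - 1) N) := by
  have : NeZero N := ⟨by omega⟩
  rw [Finset.image_insert, ZMod.val_zero, Finset.image_image]
  congr 1
  ext x
  simp only [Finset.mem_image, Finset.mem_univ, true_and, Function.comp_apply, Finset.mem_Ico]
  constructor
  · rintro ⟨⟨t, ht⟩, rfl⟩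
    rw [ZMod.val_natCast_of_lt (by simp only; omega)]
    simp only
    omega
  · rintro ⟨h₁, h₂⟩
    refine ⟨⟨x - (n - 1), by omega⟩, ?_⟩
    rw [ZMod.val_natCast_of_lt (by simp only; omega)]
    simp only
    omega

lemma cellLabels_erase {N : ℕ} [NeZero N] (T : Finset (Finset (ZMod N)))
    (α : Finset (ZMod N)) :
    cellLabels (T.erase α) = (cellLabels T).erase (α.image ZMod.val) :=
  Finset.image_erase (image_val_injective N) T α

/-- Regarding cells whose vertices are smaller than `n` as cells of the `n`-gon does not change
the labels. -/
lemma cellLabels_image_natCast {N n : ℕ} {T : Finset (Finset (ZMod N))}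
    (h : ∀ c ∈ T, ∀ w ∈ c, w.val < n) :
    cellLabels (T.image (fun c => c.image (fun w : ZMod N => ((w.val : ℕ) : ZMod n)))) =
      cellLabels T := by
  unfold cellLabels
  rw [Finset.image_image]
  refine Finset.image_congr fun c hc => ?_
  simp only [Function.comp_apply, Finset.image_image]
  exact Finset.image_congr fun w hw => ZMod.val_natCast_of_lt (h c hc w hw)

/-- Recursion for `d`-path numbers when a boundary `d`-gon is cut off.  Here the
vertices of the big `(n+d-2)`-gon are labelled `0, …, n+d-3` counterclockwise (a
shift by one of the paper's labels `1, …, n+d-2`), the diagonal between vertices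
`0` and `n-1` cuts off the boundary `d`-gon `α` with vertices
`0, n-1, n, …, n+d-3`, and `T'` is the induced `d`-angulation of the `n`-gon on
the vertices `0, …, n-1` (with the labels kept).  Then for vertices `i ≤ j` in
`{0, …, n-1}` we have `m_{i,j} = m'_{i,j}` and `m_{j,i} = m'_{j,i}`; for
`i ∈ {0, …, n-1}` and `j ∈ {n, …, n+d-3}` we have
`m_{i,j} = m'_{i,n-1} + m'_{i,0}` and `m_{j,i} = m'_{0,i} + m'_{n-1,i}`; and for
distinct `i, j ∈ {n, …, n+d-3}` we have `m_{i,j} = 1`. -/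
theorem dPathCount_cutoff (d n N : ℕ) (hd : 3 ≤ d) (hn : 3 ≤ n)
    (hN : N = n + d - 2)
    (T : Finset (Finset (ZMod N))) (hT : IsDAngulation N d T)
    (α : Finset (ZMod N)) (hαT : α ∈ T)
    (hα : α = insert (0 : ZMod N)
      (Finset.image (fun t : Fin (d - 1) => (((n - 1) + (t : ℕ) : ℕ) : ZMod N))
        Finset.univ))
    (T' : Finset (Finset (ZMod n)))
    (hT' : T' = (T.erase α).image
      (fun c => c.image (fun w : ZMod N => ((w.val : ℕ) : ZMod n)))) :
    (∀ i j : ℕ, i < n → j < n → i ≤ j →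
      dPathCount N d T (i : ZMod N) (j : ZMod N)
          = dPathCount n d T' (i : ZMod n) (j : ZMod n) ∧
      dPathCount N d T (j : ZMod N) (i : ZMod N)
          = dPathCount n d T' (j : ZMod n) (i : ZMod n)) ∧
    (∀ i j : ℕ, i < n → n ≤ j → j < N →
      dPathCount N d T (i : ZMod N) (j : ZMod N)
          = dPathCount n d T' (i : ZMod n) ((n - 1 : ℕ) : ZMod n)
            + dPathCount n d T' (i : ZMod n) (0 : ZMod n) ∧
      dPathCount N d T (j : ZMod N) (i : ZMod N)
          = dPathCount n d T' (0 : ZMod n) (i : ZMod n)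
            + dPathCount n d T' ((n - 1 : ℕ) : ZMod n) (i : ZMod n)) ∧
    (∀ i j : ℕ, n ≤ i → i < N → n ≤ j → j < N → i ≠ j →
      dPathCount N d T (i : ZMod N) (j : ZMod N) = 1) := by

  have : NeZero N := ⟨by omega⟩
  have : NeZero n := ⟨by omega⟩
  set 𝒯 := cellLabels T with h𝒯
  set A : Finset ℕ := insert 0 (Finset.Ico (n - 1) N) with hA
  have hαA : α.image ZMod.val = A := by rw [hα, image_val_cutoff_cell hd hn hN]
  have hA𝒯 : A ∈ 𝒯 := hαA ▸ Finset.mem_image_of_mem _ hαT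
  have hNC : Noncrossing 𝒯 := hT.noncrossing_cellLabels hd
  have hcard : ∀ c ∈ 𝒯, c.card = d := fun c hc => hT.card_of_mem_cellLabels hc
  have hsub : ∀ c ∈ 𝒯.erase A, c ⊆ Finset.Icc 0 (n - 1) := fun c hc =>
    hNC.subset_Icc_of_ne (fun e he => (hcard e he).trans (hcard A hA𝒯).symm) hA𝒯 (by omega)
      (by omega) (fun e he x hx => lt_of_mem_cellLabels he hx) (Finset.mem_of_mem_erase hc)
      (Finset.ne_of_mem_erase hc)
  have hT'𝒯 : cellLabels T' = 𝒯.erase A := by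
    rw [hT', cellLabels_image_natCast, cellLabels_erase, hαA]
    intro c hc w hw
    have hmem : c.image ZMod.val ∈ 𝒯.erase A := by
      rw [← hαA, ← cellLabels_erase]
      exact Finset.mem_image_of_mem _ hc
    have := Finset.mem_Icc.mp (hsub _ hmem (Finset.mem_image_of_mem _ hw))
    omega
  have hNC' : Noncrossing (𝒯.erase A) := fun e he e' he' =>
    hNC e (Finset.mem_of_mem_erase he) e' (Finset.mem_of_mem_erase he')
  have hcard' : ∀ c ∈ 𝒯.erase A, c.card = d := fun c hc => hcard c (Finset.mem_of_mem_erase hc)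
  have hex' : ∀ k ∈ Finset.Ioo 0 (n - 1), ∃ c ∈ 𝒯.erase A, k ∈ innerVertices c := by
    intro k hk
    rw [Finset.mem_Ioo] at hk
    obtain ⟨c, hc, hkc⟩ := hT.exists_mem_innerVertices (by omega) hk.1 (by omega)
    refine ⟨c, Finset.mem_erase.mpr ⟨?_, hc⟩, hkc⟩
    rintro rfl
    have := (mem_innerVertices.mp hkc).1
    rw [hA, Finset.mem_insert, Finset.mem_Ico] at this
    omega
  set W : Finset ℕ → ℕ := fun S => (assignments (d - 2) (𝒯.erase A) S).ncard with hW
  have hW_one : W (Finset.Ioo 0 (n - 1)) = 1 := hNC'.ncard_assignments_Ioo hd hcard' hsub hex'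
  have hW_zero : ∀ S : Finset ℕ, n - 1 ≤ S.card → W S = 0 := by
    intro S hS
    have hcnt := hNC'.card_mul_eq (by omega) hcard'
      (fun c hc => innerVertices_subset_Ioo (hsub c hc)) hex'
    rw [Nat.card_Ioo] at hcnt
    simp only [hW]
    rw [assignments_eq_empty_of_card_lt (by omega), Set.ncard_empty]
  have hAP : A \ Finset.Ico n N = {0, n - 1} := by
    ext x
    simp only [hA, Finset.mem_sdiff, Finset.mem_insert, Finset.mem_Ico, Finset.mem_singleton]
    omega
  have hsplit : ∀ S : Finset ℕ, (assignments (d - 2) 𝒯 S).ncard =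
      ∑ B ∈ (S ∩ {0, n - 1}).powerset, if B.card + (S ∩ Finset.Ico n N).card ≤ d - 2
        then W ((S \ Finset.Ico n N) \ B) else 0 := by
    intro S
    rw [← hAP]
    refine ncard_assignments_eq_sum_shared (d - 2) hA𝒯 ⟨0, Finset.mem_insert_self _ _⟩ ?_ ?_ S
    · intro x hx
      rw [Finset.mem_Ico] at hx
      rw [hA, Finset.mem_insert, Finset.mem_Ico]
      omega
    · intro c hc
      rw [Finset.disjoint_left]
      intro x hx hxc
      have := Finset.mem_Icc.mp (hsub c hc hxc)
      rw [Finset.mem_Ico] at hx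
      omega
  have hbig : ∀ i j : ZMod N, dPathCount N d T i j =
      ∑ B ∈ (arc N i j ∩ {0, n - 1}).powerset,
        if B.card + (arc N i j ∩ Finset.Ico n N).card ≤ d - 2
          then W ((arc N i j \ Finset.Ico n N) \ B) else 0 := fun i j => by
    rw [dPathCount_eq_ncard, ← hsplit]
  have hsmall : ∀ i j : ZMod n, dPathCount n d T' i j = W (arc n i j) := fun i j => by
    rw [dPathCount_eq_ncard, hT'𝒯]
  have hzero : ∀ M : ℕ, (0 : ZMod M) = ((0 : ℕ) : ZMod M) := fun M => Nat.cast_zero.symm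
  have hempty : ∀ S R : Finset ℕ, S ∩ {0, n - 1} = ∅ → (S ∩ Finset.Ico n N).card ≤ d - 2 →
      S \ Finset.Ico n N = R → (∑ B ∈ (S ∩ {0, n - 1}).powerset,
        if B.card + (S ∩ Finset.Ico n N).card ≤ d - 2
          then W ((S \ Finset.Ico n N) \ B) else 0) = W R := by
    rintro S R h hle rfl
    rw [h]
    simp [hle]
  have hsingle : ∀ (S R R' : Finset ℕ) (x : ℕ), S ∩ {0, n - 1} = {x} →
      (S ∩ Finset.Ico n N).card < d - 2 → S \ Finset.Ico n N = R → R \ {x} = R' →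
      (∑ B ∈ (S ∩ {0, n - 1}).powerset,
        if B.card + (S ∩ Finset.Ico n N).card ≤ d - 2
          then W ((S \ Finset.Ico n N) \ B) else 0) = W R + W R' := by
    rintro S R R' x h hlt rfl rfl
    rw [h, show ({x} : Finset ℕ) = insert x ∅ from rfl,
      Finset.sum_powerset_insert (Finset.notMem_empty x)]
    simp [hlt.le, show 1 + (S ∩ Finset.Ico n N).card ≤ d - 2 by omega]
  have hfull : ∀ S R : Finset ℕ, Finset.Ico n N ⊆ S → S \ Finset.Ico n N = R →
      (∑ B ∈ (S ∩ {0, n - 1}).powerset,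
        if B.card + (S ∩ Finset.Ico n N).card ≤ d - 2
          then W ((S \ Finset.Ico n N) \ B) else 0) = W R := by
    rintro S R h rfl
    have hP : (S ∩ Finset.Ico n N).card = d - 2 := by
      rw [Finset.inter_eq_right.mpr h, Nat.card_Ico]
      omega
    rw [Finset.sum_eq_single ∅]
    · simp [hP]
    · intro B _ hB
      have := Finset.card_pos.mpr (Finset.nonempty_iff_ne_empty.mpr hB)
      exact if_neg (by omega)
    · exact fun h => absurd (Finset.empty_mem_powerset _) h
  have hdown : ∀ i j : ℕ, j < n → i ≤ j → dPathCount N d T (j : ZMod N) (i : ZMod N) =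
      dPathCount n d T' (j : ZMod n) (i : ZMod n) := by
    intro i j hj hij
    rw [hbig, hsmall, arc_of_le hij (by omega), arc_of_le hij hj]
    apply hfull
    · intro x
      simp only [Finset.mem_Ico, Finset.mem_union, Finset.mem_Ioo, Finset.mem_range]
      omega
    · ext x
      simp only [Finset.mem_sdiff, Finset.mem_Ico, Finset.mem_union, Finset.mem_Ioo,
        Finset.mem_range]
      omega
  have hsubcard : ∀ S R : Finset ℕ, S ∩ Finset.Ico n N ⊆ R → R.card < d - 2 →
      (S ∩ Finset.Ico n N).card < d - 2 := fun S R h hR => (Finset.card_le_card h).trans_lt hR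
  have hn₁ : n - 1 < n := by omega
  refine ⟨fun i j hi hj hij => ⟨?_, hdown i j hj hij⟩, fun i j hi hj hjN => ⟨?_, ?_⟩,
    fun i j hi hiN hj hjN hij => ?_⟩
  · rcases hij.eq_or_lt with rfl | hlt
    · exact hdown i i hi le_rfl
    rw [hbig, hsmall, arc_of_lt hlt (by omega), arc_of_lt hlt hj]
    have hS : Finset.Ioo i j ∩ Finset.Ico n N = ∅ := by
      ext x
      simp
      omega
    apply hempty
    · ext x
      simp
      omega
    · simp [hS]
    · rw [← Finset.sdiff_inter_self_left, hS, Finset.sdiff_empty]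
  · rw [hbig, hsmall, hsmall, hzero n, arc_of_lt (show i < j by omega) hjN,
      arc_of_le (Nat.zero_le i) hi]
    have hlt : (Finset.Ioo i j ∩ Finset.Ico n N).card < d - 2 := by
      apply hsubcard _ (Finset.Ico n j)
      · intro x
        simp
        omega
      · rw [Nat.card_Ico]
        omega
    rcases (Nat.le_sub_one_of_lt hi).eq_or_lt with rfl | hi'
    · rw [arc_of_le le_rfl hn₁, hW_zero _ (by
        rw [Finset.card_union_of_disjoint]
        · simp
        · rw [Finset.disjoint_left]
          intro x
          simp
          omega), zero_add]
      apply hempty _ _ _ hlt.le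
      · ext x
        simp
        omega
      · ext x
        simp
    · rw [arc_of_lt hi' hn₁, add_comm]
      apply hsingle _ _ _ (n - 1) _ hlt
      · ext x
        simp
        omega
      · ext x
        simp
        omega
      · ext x
        simp
        omega
  · rw [hbig, hsmall, hsmall, hzero n, arc_of_le (show i ≤ j by omega) hjN,
      arc_of_le (show i ≤ n - 1 by omega) hn₁]
    have hlt : ((Finset.Ioo j N ∪ Finset.range i) ∩ Finset.Ico n N).card < d - 2 := by
      apply hsubcard _ (Finset.Ioo j N)
      · intro x
        simp
        omega
      · rw [Nat.card_Ioo]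
        omega
    rcases Nat.eq_zero_or_pos i with rfl | hi'
    · rw [arc_of_le le_rfl hi, hW_zero (Finset.Ioo 0 n ∪ Finset.range 0) (by simp), zero_add]
      apply hempty _ _ _ hlt.le
      · ext x
        simp
        omega
      · ext x
        simp
        omega
    · rw [arc_of_lt hi' hi, add_comm]
      apply hsingle _ _ _ 0 _ hlt
      · ext x
        simp
        omega
      · ext x
        simp
        omega
      · ext x
        simp
        omega
  · rw [hbig]
    rcases lt_or_gt_of_ne hij with hlt | hgt
    · rw [arc_of_lt hlt hjN, hempty _ ∅]
      · exact ncard_assignments_empty _ _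
      · ext x
        simp
        omega
      · apply le_of_lt
        apply hsubcard _ (Finset.Ioo i j)
        · intro x
          simp
          omega
        · rw [Nat.card_Ioo]
          omega
      · ext x
        simp
        omega
    · rw [arc_of_le hgt.le hiN]
      set S := Finset.Ioo i N ∪ Finset.range j with hS
      have hSP : (S ∩ Finset.Ico n N).card + 2 ≤ d - 2 := by
        have hsubS : S ∩ Finset.Ico n N ⊆ (Finset.Ico n N \ {i, j}) := by
          intro x
          simp [hS]
          omega
        have hle := Finset.card_le_card hsubS
        rw [Finset.card_sdiff_of_subset (by
          intro x
          simp
          omega), Finset.card_pair hij, Nat.card_Ico] at hle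
        have : 2 ≤ N - n := by omega
        omega
      have hS₁ : S ∩ {0, n - 1} = {0, n - 1} := by
        ext x
        simp [hS]
        omega
      have hS₂ : S \ Finset.Ico n N = Finset.range n := by
        ext x
        simp [hS]
        omega
      have hS₃ : Finset.range n \ {0, n - 1} = Finset.Ioo 0 (n - 1) := by
        ext x
        simp
        omega
      have hzero' : ∀ B : Finset ℕ, B.card ≤ 1 → W (Finset.range n \ B) = 0 := fun B hB =>
        hW_zero _ (by
          have := Finset.le_card_sdiff B (Finset.range n)
          rw [Finset.card_range] at this
          omega)
      rw [hS₁, hS₂, Finset.sum_eq_single {0, n - 1}]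
      · rw [if_pos (by rw [Finset.card_pair (by omega)]; omega), hS₃, hW_one]
      · intro B hB hne
        have hlt := Finset.card_lt_card ((Finset.mem_powerset.mp hB).ssubset_of_ne hne)
        rw [Finset.card_pair (by omega)] at hlt
        rw [hzero' B (by omega), ite_self]
      · exact fun h => absurd (Finset.mem_powerset_self _) h
end
end
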